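/- arXiv:1410.3378 — 2 statements merged into one kernel-verified Lean document; each statement's English description precedes it below -/
import Mathlib

section
/- Let K be a number field containing a primitive d-th root of unity, with ring of integers 𝓞_K, let d ≥ 2, let c ∈ 𝓞_K, and let f(x) = x^d + c. Suppose 0 is not preperiodic under f, i.e., f^{∘m}(0) ≠ f^{∘n}(0) for all integers m > n ≥ 0. Then for every ε > 0 there exists M such that every nonzero prime ideal 𝔭 of 𝓞_K with N(𝔭) > M satisfies #Per(f_𝔭) ≤ ε·(N(𝔭) + 1); that is, #Per(f_𝔭)/(N(𝔭)+1) → 0 as N(𝔭) → ∞. -/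
open NumberField Polynomial

/-- The number of periodic points of the self-map of `R ⧸ I` induced by a polynomial
`f ∈ R[x]` (reduce the coefficients of `f` modulo `I` and iterate evaluation). -/
noncomputable def perCount {R : Type*} [CommRing R] (f : Polynomial R) (I : Ideal R) : ℕ :=
  Set.ncard {z : R ⧸ I | ∃ m : ℕ, 0 < m ∧
    (fun w => (f.map (Ideal.Quotient.mk I)).eval w)^[m] z = z}

universe u

section Unicritical

/-- Filtered algebra data used for the Stepanov argument. -/
structure Pkg (k : Type u) [Field k] (R : Type u) [CommRing R] [Algebra k R]
    (D s e : ℕ) where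
  W : ℕ → Submodule k R
  mono : Monotone W
  fin : ∀ n, FiniteDimensional k (W n)
  rank : ∀ n, Module.finrank k (W n) = (n + 1) * D
  exh : ∀ x, ∃ n, x ∈ W n
  one : (1 : R) ∈ W 0
  mul : ∀ a b x y, x ∈ W a → y ∈ W b → x * y ∈ W (a + b + s)
  δ : Derivation k R R
  hδ : ∀ n x, x ∈ W n → δ x ∈ W (n + e)
  t : R
  finHom : Finite (R →ₐ[k] k)

variable {k : Type u} [Field k] {R : Type u} [CommRing R] [Algebra k R]

/-- Elements vanishing to order `M` at the point `P`. -/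
def van (δ : Derivation k R R) (P : R →ₐ[k] k) : ℕ → Ideal R
  | 0 => ⊤
  | M + 1 =>
    { carrier := {f | P f = 0 ∧ f ∈ van δ P M ∧ δ f ∈ van δ P M}
      add_mem' := by
        rintro a b ⟨h1, h2, h3⟩ ⟨h4, h5, h6⟩
        refine ⟨by simp [h1, h4], add_mem h2 h5, ?_⟩
        rw [map_add]; exact add_mem h3 h6
      zero_mem' := by simp
      smul_mem' := by
        rintro c x ⟨h1, h2, h3⟩
        refine ⟨by simp [h1], Ideal.mul_mem_left _ _ h2, ?_⟩
        rw [smul_eq_mul, Derivation.leibniz, smul_eq_mul, smul_eq_mul]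
        exact add_mem (Ideal.mul_mem_left _ _ h3) (Ideal.mul_mem_right _ _ h2) }

lemma mem_van_succ {δ : Derivation k R R} {P : R →ₐ[k] k} {M : ℕ} {f : R} :
    f ∈ van δ P (M + 1) ↔ P f = 0 ∧ f ∈ van δ P M ∧ δ f ∈ van δ P M := Iff.rfl

lemma mem_van_of_derivs {δ : Derivation k R R} {P : R →ₐ[k] k} :
    ∀ (M : ℕ) (f : R), (∀ j < M, P (δ^[j] f) = 0) → f ∈ van δ P M
  | 0, f, _ => by simp [van]
  | M + 1, f, h => by
    refine ⟨by simpa using h 0 (by omega), mem_van_of_derivs M f fun j hj => h j (by omega),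
      mem_van_of_derivs M _ fun j hj => ?_⟩
    simpa using h (j + 1) (by omega)

lemma mul_mem_van {δ : Derivation k R R} {P : R →ₐ[k] k} {g : R} (hg : P g = 0) :
    ∀ (M : ℕ) (f : R), f ∈ van δ P M → g * f ∈ van δ P (M + 1)
  | 0, f, _ => by simp [van, hg]
  | M + 1, f, h => by
    refine ⟨by simp [hg], Ideal.mul_mem_left _ _ h, ?_⟩
    rw [Derivation.leibniz, smul_eq_mul, smul_eq_mul]
    exact add_mem (mul_mem_van hg M _ h.2.2) (Ideal.mul_mem_right _ _ h)

lemma ker_pow_le_van (δ : Derivation k R R) (P : R →ₐ[k] k) :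
    ∀ M : ℕ, (RingHom.ker P) ^ M ≤ van δ P M
  | 0 => by simp [van]
  | M + 1 => by
    rw [pow_succ', Ideal.mul_le]
    intro g hg f hf
    exact mul_mem_van hg M f (ker_pow_le_van δ P M hf)

lemma van_coprime (δ : Derivation k R R) {P Q : R →ₐ[k] k} (h : P ≠ Q) (M : ℕ) :
    IsCoprime (van δ P M) (van δ Q M) := by
  have h1 : IsCoprime (RingHom.ker P) (RingHom.ker Q) := by
    have hex : ∃ x, P x ≠ Q x := by
      by_contra hc; push Not at hc; exact h (AlgHom.ext hc)
    obtain ⟨x, hx⟩ := hex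
    have hne : P x - Q x ≠ 0 := sub_ne_zero.2 hx
    rw [Ideal.isCoprime_iff_exists]
    refine ⟨algebraMap k R (P x - Q x)⁻¹ * (algebraMap k R (P x) - x), ?_,
      algebraMap k R (P x - Q x)⁻¹ * (x - algebraMap k R (Q x)), ?_, ?_⟩
    · simp [RingHom.mem_ker]
    · simp [RingHom.mem_ker]
    · rw [← mul_add, sub_add_sub_cancel, ← map_sub, ← map_mul, inv_mul_cancel₀ hne, map_one]
  have h2 := IsCoprime.pow (m := M) (n := M) h1
  rw [Ideal.isCoprime_iff_sup_eq] at h2 ⊢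
  rw [eq_top_iff, ← h2]
  exact sup_le_sup (ker_pow_le_van δ P M) (ker_pow_le_van δ Q M)

lemma van_cancel {δ : Derivation k R R} {P : R →ₐ[k] k} {g : R} (hg : P g ≠ 0) :
    ∀ (M : ℕ) (f : R), f * g ∈ van δ P M → f ∈ van δ P M
  | 0, f, _ => by simp [van]
  | M + 1, f, h => by
    obtain ⟨h1, h2, h3⟩ := h
    have hf := van_cancel hg M f h2
    refine ⟨by simpa [hg] using h1, hf, van_cancel hg M _ ?_⟩
    rw [Derivation.leibniz, smul_eq_mul, smul_eq_mul] at h3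
    have := sub_mem h3 (Ideal.mul_mem_right (δ g) _ hf)
    rwa [add_sub_cancel_left, mul_comm] at this

lemma poly_van {δ : Derivation k R R} {P : R →ₐ[k] k} {t : R} (ht : P (δ t) ≠ 0) :
    ∀ (M : ℕ) (h : k[X]), (∀ j : ℕ, 0 < j → j < M → (j : k) ≠ 0) → h.degree < M →
      aeval (t - algebraMap k R (P t)) h ∈ van δ P M → h = 0
  | 0, h, _, hdeg, _ => by simpa using hdeg
  | M + 1, h, hj, hdeg, hm => by
    obtain ⟨h1, h2, h3⟩ := hm
    have hδ : δ (aeval (t - algebraMap k R (P t)) h)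
        = aeval (t - algebraMap k R (P t)) (derivative h) * δ t := by
      rw [Derivation.map_aeval]; simp
    rw [hδ] at h3
    have hc : ∀ n, M + 1 ≤ n → h.coeff n = 0 := fun n hn =>
      coeff_eq_zero_of_degree_lt (lt_of_lt_of_le hdeg (by exact_mod_cast hn))
    have h4 := poly_van ht M (derivative h) (fun j h0 hlt => hj j h0 (by omega)) (by
      rw [degree_lt_iff_coeff_zero]
      intro n hn
      rw [coeff_derivative, hc (n + 1) (by omega), zero_mul]) (van_cancel ht M _ h3)
    have h0 : h.coeff 0 = 0 := by
      rw [← Polynomial.aeval_algHom_apply] at h1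
      simpa [Polynomial.aeval_def, eval₂_at_zero] using h1
    ext n
    rcases n with _ | n
    · simpa using h0
    · by_cases hn : M + 1 ≤ n + 1
      · simp [hc _ hn]
      · have := congrArg (fun q => q.coeff n) h4
        simp only [coeff_derivative, coeff_zero] at this
        rcases mul_eq_zero.1 this with h5 | h5
        · simpa using h5
        · exact absurd (by exact_mod_cast h5) (hj (n + 1) (by omega) (by omega))

variable {D s e : ℕ}

/-- Codimension count. -/
lemma Pkg.codim [IsDomain R] (pk : Pkg k R D s e) {V : Type*} [AddCommGroup V] [Module k V]
    (φ : R →ₗ[k] V) {f : R} (hf : f ≠ 0) {n : ℕ} (hfn : f ∈ pk.W n)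
    (hφ : ∀ g, φ (f * g) = 0) {ι : Type*} [Fintype ι] (x : ι → R)
    (hx : LinearIndependent k (fun i => φ (x i))) : Fintype.card ι ≤ D * (n + s) := by
  classical
  choose N hN using fun i => pk.exh (x i)
  obtain ⟨L, hL⟩ : ∃ L, ∀ i, x i ∈ pk.W (L + n + s) :=
    ⟨Finset.univ.sup N, fun i => pk.mono (by
      have := Finset.le_sup (f := N) (Finset.mem_univ i); omega) (hN i)⟩
  have := pk.fin
  let A : Submodule k R := (pk.W L).map (LinearMap.mulLeft k f)
  let B : Submodule k R := Submodule.span k (Set.range x)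
  have hxi : LinearIndependent k x := LinearIndependent.of_comp φ hx
  have hA : Module.finrank k A = (L + 1) * D := by
    rw [← pk.rank L]
    exact ((Submodule.equivMapOfInjective (LinearMap.mulLeft k f)
      (fun a b h => mul_left_cancel₀ hf h) (pk.W L)).finrank_eq).symm
  have hB : Module.finrank k B = Fintype.card ι := finrank_span_eq_card hxi
  have hAW : A ≤ pk.W (L + n + s) := by
    rintro _ ⟨g, hg, rfl⟩
    have := pk.mul n L f g hfn hg
    rwa [add_comm n L] at this
  have hBW : B ≤ pk.W (L + n + s) := by
    rw [Submodule.span_le]; rintro _ ⟨i, rfl⟩; exact hL i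
  have hdis : A ⊓ B = ⊥ := by
    rw [eq_bot_iff]
    rintro y ⟨⟨g, hg, rfl⟩, hy⟩
    have hy' := hy
    rw [SetLike.mem_coe, Submodule.mem_span_range_iff_exists_fun] at hy
    obtain ⟨c, hc⟩ := hy
    have h0 : ∑ i, c i • φ (x i) = 0 := by
      have := congrArg φ hc
      simpa [hφ] using this
    have hc0 := Fintype.linearIndependent_iff.1 hx c h0
    rw [Submodule.mem_bot, ← hc]
    simp [hc0]
  have : FiniteDimensional k A := Submodule.finiteDimensional_of_le hAW
  have : FiniteDimensional k B := Submodule.finiteDimensional_of_le hBW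
  have h1 := Submodule.finrank_sup_add_finrank_inf_eq A B
  rw [hdis, finrank_bot, hA, hB] at h1
  have h2 := Submodule.finrank_mono (sup_le hAW hBW)
  rw [pk.rank] at h2
  nlinarith

lemma Pkg.zero_count [IsDomain R] (pk : Pkg k R D s e) (S : Finset (R →ₐ[k] k))
    (hS : ∀ P ∈ S, P (pk.δ pk.t) ≠ 0) {f : R} (hf : f ≠ 0) {n : ℕ} (hfn : f ∈ pk.W n)
    (M : ℕ) (hM : ∀ j : ℕ, 0 < j → j < M → (j : k) ≠ 0)
    (hv : ∀ P ∈ S, f ∈ van pk.δ P M) : S.card * M ≤ D * (n + s) := by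
  classical
  let I : S → Ideal R := fun P => van pk.δ P.1 M
  have hI : Pairwise (Function.onFun IsCoprime I) := fun P Q h =>
    van_coprime pk.δ (fun h' => h (Subtype.ext h')) M
  let φ : R →ₗ[k] (∀ P : S, R ⧸ I P) := LinearMap.pi fun P => (Ideal.Quotient.mkₐ k (I P)).toLinearMap
  have hφs : Function.Surjective φ := by
    intro y
    obtain ⟨r, hr⟩ := Ideal.pi_quotient_surjective hI y
    exact ⟨r, funext hr⟩
  let v : ∀ P : S, Fin M → R ⧸ I P := fun P j =>
    Ideal.Quotient.mkₐ k (I P) ((pk.t - algebraMap k R (P.1 pk.t)) ^ (j : ℕ))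
  have hvi : ∀ P, LinearIndependent k (v P) := by
    intro P
    rw [Fintype.linearIndependent_iff]
    intro g hg
    let h : k[X] := ∑ j : Fin M, monomial (j : ℕ) (g j)
    have h1 : aeval (pk.t - algebraMap k R (P.1 pk.t)) h ∈ van pk.δ P.1 M := by
      have : Ideal.Quotient.mkₐ k (I P) (aeval (pk.t - algebraMap k R (P.1 pk.t)) h) = 0 := by
        rw [← hg]
        simp [h, v, aeval_monomial, Algebra.smul_def]
      exact Ideal.Quotient.eq_zero_iff_mem.1 this
    have h2 : h = 0 := by
      refine poly_van (hS _ P.2) M h hM ?_ h1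
      rw [degree_lt_iff_coeff_zero]
      intro n hn
      simp only [h, finsetSum_coeff, coeff_monomial]
      exact Finset.sum_eq_zero fun j _ => if_neg (by have := j.2; omega)
    intro i
    have h3 := congrArg (fun q => q.coeff (i : ℕ)) h2
    simpa [h, finsetSum_coeff, coeff_monomial, Fin.val_inj] using h3
  have hli := Pi.linearIndependent_single v hvi
  choose x hx using fun ji : (Σ _ : S, Fin M) => hφs (Pi.single ji.1 (v ji.1 ji.2))
  have := pk.codim φ hf hfn (fun g => by
    funext P
    exact Ideal.Quotient.eq_zero_iff_mem.2 (Ideal.mul_mem_right _ _ (hv P.1 P.2))) x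
    (by simpa only [hx] using hli)
  simpa using this

lemma Pkg.pow_mem (pk : Pkg k R D s e) {m : ℕ} {x : R} (hx : x ∈ pk.W m) (n : ℕ) :
    x ^ n ∈ pk.W (n * (m + s)) := by
  induction n with
  | zero => simpa using pk.one
  | succ n ih =>
    rw [pow_succ]
    have := pk.mul _ _ _ _ ih hx
    rwa [add_assoc, ← Nat.succ_mul] at this

lemma Pkg.iter_mem (pk : Pkg k R D s e) {n : ℕ} {x : R} (hx : x ∈ pk.W n) (r : ℕ) :
    pk.δ^[r] x ∈ pk.W (n + r * e) := by
  induction r with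
  | zero => simpa using hx
  | succ r ih =>
    rw [Function.iterate_succ_apply']
    have := pk.hδ _ _ ih
    rwa [add_assoc, ← Nat.succ_mul] at this

lemma iter_mul_const (δ : Derivation k R R) {y : R} (hy : δ y = 0) (x : R) (r : ℕ) :
    δ^[r] (x * y) = δ^[r] x * y := by
  induction r with
  | zero => rfl
  | succ r ih =>
    rw [Function.iterate_succ_apply', Function.iterate_succ_apply', ih, Derivation.leibniz, hy]
    simp [mul_comm]

lemma iter_sum_smul (δ : Derivation k R R) {ι : Type*} (S : Finset ι) (c : ι → k) (x : ι → R)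
    (r : ℕ) : δ^[r] (∑ i ∈ S, c i • x i) = ∑ i ∈ S, c i • δ^[r] (x i) := by
  induction r with
  | zero => rfl
  | succ r ih =>
    simp only [Function.iterate_succ_apply', ih, map_sum, Derivation.map_smul]

/-- Stepanov's bound with the constant `2`. -/
theorem stepanov [Fintype k] [IsDomain R] (hD : 0 < D) (pk : Pkg k R D s e) (μ M l C : ℕ)
    (hμ : μ = s + 1) (hM : M = D * μ) (hl : l = M * (M * e + μ + s))
    (hC : C = l + 2 * s + D * (μ + s) + M + D * (l + s) + 2)
    (hp : ∀ j : ℕ, 0 < j → j ≤ C → (j : k) ≠ 0)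
    (S : Finset (R →ₐ[k] k)) (hS : ∀ P ∈ S, P (pk.δ pk.t) ≠ 0) :
    S.card ≤ 2 * Fintype.card k + C := by
  classical
  have := pk.fin
  set q := Fintype.card k with hq
  let N := l + M * e + μ + s
  let ν := Module.finBasis k (pk.W l)
  let σ := Module.finBasis k (pk.W μ)
  have hmem : ∀ (r : Fin M) i j, pk.δ^[r] (ν i : R) * (σ j : R) ∈ pk.W N := fun r i j => by
    refine pk.mono ?_ (pk.mul _ _ _ _ (pk.iter_mem (ν i).2 r) (σ j).2)
    have := Nat.mul_le_mul_right e r.2.le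
    omega
  let x : (Fin _ × Fin _) → (Fin M → pk.W N) := fun ij r => ⟨_, hmem r ij.1 ij.2⟩
  have hdep : ¬ LinearIndependent k x := by
    intro h
    have := h.fintype_card_le_finrank
    rw [Module.finrank_pi_fintype] at this
    simp only [Fintype.card_prod, Fintype.card_fin, pk.rank, Finset.sum_const, Finset.card_univ,
      smul_eq_mul] at this
    have h1 : (l + 1) * D * ((μ + 1) * D) = D * ((l + 1) * (M + D)) := by rw [hM]; ring
    have h2 : M * ((N + 1) * D) = D * (M * (N + 1)) := by ring
    rw [h1, h2] at this
    have h3 := Nat.le_of_mul_le_mul_left this hD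
    have h4 : M * (N + 1) = M * (l + 1) + l := by simp only [N]; rw [hl]; ring
    rw [h4] at h3
    nlinarith
  rw [Fintype.not_linearIndependent_iff] at hdep
  obtain ⟨a, ha0, ⟨i0, j0⟩, hij⟩ := hdep
  have hrel : ∀ r < M, ∑ ij, a ij • (pk.δ^[r] (ν ij.1 : R) * (σ ij.2 : R)) = 0 := by
    intro r hr
    have := congrArg (fun w : Fin M → pk.W N => ((w ⟨r, hr⟩ : pk.W N) : R)) ha0
    simpa [x, Finset.sum_apply] using this
  let F : R := ∑ ij, a ij • ((ν ij.1 : R) * (σ ij.2 : R) ^ q)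
  have hq0 : (q : k) = 0 := FiniteField.cast_card_eq_zero k
  have hδq : ∀ y : R, pk.δ (y ^ q) = 0 := fun y => by
    rw [Derivation.leibniz_pow, ← Nat.cast_smul_eq_nsmul k, hq0, zero_smul]
  have hder : ∀ r, pk.δ^[r] F = ∑ ij, a ij • (pk.δ^[r] (ν ij.1 : R) * (σ ij.2 : R) ^ q) := by
    intro r
    rw [iter_sum_smul]
    simp only [iter_mul_const pk.δ (hδq _)]
  have hPq : ∀ (P : R →ₐ[k] k) r, P (pk.δ^[r] F)
      = P (∑ ij, a ij • (pk.δ^[r] (ν ij.1 : R) * (σ ij.2 : R))) := by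
    intro P r
    rw [hder]
    simp only [map_sum, map_smul, map_mul, map_pow, hq, FiniteField.pow_card]
  have hFW : F ∈ pk.W (l + q * (μ + s) + s) :=
    Submodule.sum_mem _ fun ij _ => Submodule.smul_mem _ _
      (pk.mul _ _ _ _ (ν ij.1).2 (pk.pow_mem (σ ij.2).2 q))
  by_cases hF : F = 0
  · -- the coefficients vanish at all points of `S`
    let h : R := ∑ j, a (i0, j) • (σ j : R)
    have hh0 : h ≠ 0 := by
      intro hh
      have : ∑ j, a (i0, j) • σ j = 0 := by
        apply Subtype.ext
        simpa [h] using hh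
      exact hij (Fintype.linearIndependent_iff.1 σ.linearIndependent _ this j0)
    have hhW : h ∈ pk.W μ := Submodule.sum_mem _ fun j _ => Submodule.smul_mem _ _ (σ j).2
    have hvan : ∀ P ∈ S, h ∈ van pk.δ P 1 := by
      intro P hP
      apply mem_van_of_derivs
      intro r hr
      obtain rfl : r = 0 := by omega
      let g : R := ∑ i, (∑ j, a (i, j) * P (σ j : R)) • (ν i : R)
      have hgW : g ∈ pk.W l := Submodule.sum_mem _ fun j _ => Submodule.smul_mem _ _ (ν j).2
      have hgd : ∀ r, P (pk.δ^[r] g) = 0 := by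
        intro r
        have h1 := hPq P r
        rw [hF] at h1
        have h2 : pk.δ^[r] (0 : R) = 0 := by
          have := iter_sum_smul pk.δ (∅ : Finset ℕ) (fun _ => 0) (fun _ => 0) r
          simpa using this
        rw [h2, map_zero] at h1
        rw [h1, iter_sum_smul, map_sum, map_sum, Fintype.sum_prod_type]
        refine Finset.sum_congr rfl fun i _ => ?_
        rw [map_smul, smul_eq_mul, Finset.sum_mul]
        refine Finset.sum_congr rfl fun j _ => ?_
        rw [map_smul, map_mul, smul_eq_mul]; ring
      have hg0 : g = 0 := by
        by_contra hg
        have := pk.zero_count {P} (by simpa using hS P hP) hg hgW (D * (l + s) + 1)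
          (fun j h1 h2 => hp j h1 (by omega))
          (by
            intro Q hQ
            rw [Finset.mem_singleton] at hQ
            subst hQ
            exact mem_van_of_derivs _ _ fun j _ => hgd j)
        simp at this
      have hz : ∑ i, (∑ j, a (i, j) * P (σ j : R)) • ν i = 0 := by
        apply Subtype.ext
        simpa [g] using hg0
      have := Fintype.linearIndependent_iff.1 ν.linearIndependent _ hz i0
      simpa [h] using this
    have := pk.zero_count S hS hh0 hhW 1 (fun j h1 h2 => by omega) hvan
    omega
  · have := pk.zero_count S hS hF hFW M (fun j h1 h2 => hp j h1 (by omega)) (by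
      intro P _
      apply mem_van_of_derivs
      intro r hr
      rw [hPq, hrel r hr, map_zero])
    have h1 : S.card * M = D * (S.card * μ) := by rw [hM]; ring
    rw [h1] at this
    have h2 := Nat.le_of_mul_le_mul_left this hD
    have h3 : q * (μ + s) ≤ q * (2 * μ) := Nat.mul_le_mul_left _ (by omega)
    have h4 : S.card * μ ≤ (2 * q + (l + 2 * s)) * μ := by
      have : l + 2 * s ≤ (l + 2 * s) * μ := Nat.le_mul_of_pos_right _ (by omega)
      nlinarith
    have := Nat.le_of_mul_le_mul_right h4 (by omega)
    omega

end Unicritical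

section Ext
variable {k : Type u} [Field k] {R : Type u} [CommRing R] [Algebra k R]

/-- the cyclic extension obtained by adjoining a `d`-th root of `a` -/
abbrev Kum (d : ℕ) (a : R) : Type u := AdjoinRoot (X ^ d - C a : R[X])

noncomputable abbrev Kum.z (d : ℕ) (a : R) : Kum d a := AdjoinRoot.root _
noncomputable abbrev Kum.o (d : ℕ) (a : R) : R →+* Kum d a := AdjoinRoot.of _

lemma Kum.z_pow (d : ℕ) (a : R) : Kum.z d a ^ d = Kum.o d a a := by
  have h := AdjoinRoot.eval₂_root (X ^ d - C a : R[X])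
  rw [eval₂_sub, eval₂_X_pow, eval₂_C, sub_eq_zero] at h
  exact h

lemma Kum.o_smul (d : ℕ) (a : R) (r : k) (x : R) : Kum.o d a (r • x) = r • Kum.o d a x := by
  have : algebraMap k (Kum d a) r = Kum.o d a (algebraMap k R r) := rfl
  rw [Algebra.smul_def, map_mul, Algebra.smul_def, this]

/-- coordinates -/
noncomputable def Kum.basis [Nontrivial R] (d : ℕ) (hd : 0 < d) (a : R) :
    Module.Basis (Fin d) R (Kum d a) :=
  (AdjoinRoot.powerBasisAux' (monic_X_pow_sub_C a hd.ne')).reindex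
    (finCongr (natDegree_X_pow_sub_C))

lemma Kum.basis_apply [Nontrivial R] (d : ℕ) (hd : 0 < d) (a : R) (i : Fin d) :
    Kum.basis d hd a i = Kum.z d a ^ (i : ℕ) := by
  have h := (AdjoinRoot.powerBasis' (monic_X_pow_sub_C a hd.ne')).basis_eq_pow
    ((finCongr (natDegree_X_pow_sub_C (n := d) (r := a))).symm i)
  rw [AdjoinRoot.powerBasis'_gen] at h
  rw [Kum.basis, Module.Basis.reindex_apply]
  exact h

lemma Kum.ex_coord [Nontrivial R] (d : ℕ) (hd : 0 < d) (a : R) (x : Kum d a) :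
    ∃ g : Fin d → R, x = ∑ i, Kum.o d a (g i) * Kum.z d a ^ (i : ℕ) := by
  refine ⟨(Kum.basis d hd a).equivFun x, ?_⟩
  conv_lhs => rw [← (Kum.basis d hd a).sum_equivFun x]
  refine Finset.sum_congr rfl fun i _ => ?_
  rw [Kum.basis_apply, Algebra.smul_def]; rfl

lemma Kum.coord_inj [Nontrivial R] (d : ℕ) (hd : 0 < d) (a : R) (g : Fin d → R)
    (h : ∑ i, Kum.o d a (g i) * Kum.z d a ^ (i : ℕ) = 0) : g = 0 := by
  have := Fintype.linearIndependent_iff.1 (Kum.basis d hd a).linearIndependent g (by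
    rw [← h]; refine Finset.sum_congr rfl fun i _ => ?_
    rw [Kum.basis_apply, Algebra.smul_def]; rfl)
  funext i; exact this i

/-- coordinate map, linear over the constants -/
noncomputable def Kum.lin (k : Type u) [Field k] [Algebra k R] (d : ℕ) (a : R) :
    (Fin d → R) →ₗ[k] Kum d a where
  toFun g := ∑ i, Kum.o d a (g i) * Kum.z d a ^ (i : ℕ)
  map_add' g h := by simp [add_mul, Finset.sum_add_distrib]
  map_smul' r g := by
    simp only [Pi.smul_apply, Kum.o_smul, RingHom.id_apply, Finset.smul_sum, smul_mul_assoc]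

noncomputable def Kum.WW (d : ℕ) (a : R) (W : Submodule k R) : Submodule k (Kum d a) :=
  (Submodule.pi Set.univ (fun _ : Fin d => W)).map (Kum.lin k d a)

lemma Kum.mem_WW (d : ℕ) (a : R) (W : Submodule k R) (x : Kum d a) :
    x ∈ Kum.WW d a W ↔ ∃ g : Fin d → R, (∀ i, g i ∈ W) ∧
      x = ∑ i, Kum.o d a (g i) * Kum.z d a ^ (i : ℕ) := by
  simp only [Kum.WW, Submodule.mem_map, Submodule.mem_pi, Set.mem_univ, true_imp_iff]
  constructor
  · rintro ⟨g, h, rfl⟩; exact ⟨g, h, rfl⟩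
  · rintro ⟨g, h, rfl⟩; exact ⟨g, h, rfl⟩

lemma Kum.mono_mem (d : ℕ) (a : R) (W : Submodule k R) (g : R) (hg : g ∈ W) (i : ℕ) (hi : i < d) :
    Kum.o d a g * Kum.z d a ^ i ∈ Kum.WW d a W := by
  rw [Kum.mem_WW]
  refine ⟨Pi.single ⟨i, hi⟩ g, fun j => ?_, ?_⟩
  · by_cases h : j = ⟨i, hi⟩
    · subst h; simpa using hg
    · simp [Pi.single_eq_of_ne h]
  · rw [Finset.sum_eq_single ⟨i, hi⟩]
    · simp
    · intro j _ h; simp [Pi.single_eq_of_ne h]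
    · simp

lemma Kum.finrank_WW [Nontrivial R] (d : ℕ) (hd : 0 < d) (a : R) (W : Submodule k R)
    [FiniteDimensional k W] :
    FiniteDimensional k (Kum.WW d a W) ∧
    Module.finrank k (Kum.WW d a W) = d * Module.finrank k W := by
  let e : (Fin d → W) →ₗ[k] Kum d a := (Kum.lin k d a) ∘ₗ
    (LinearMap.pi fun i => W.subtype ∘ₗ LinearMap.proj i)
  have he : Function.Injective e := by
    rw [← LinearMap.ker_eq_bot, LinearMap.ker_eq_bot']
    intro g hg
    have := Kum.coord_inj d hd a (fun i => (g i : R)) hg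
    funext i; exact Subtype.ext (congrFun this i)
  have hr : LinearMap.range e = Kum.WW d a W := by
    ext x
    rw [Kum.mem_WW, LinearMap.mem_range]
    constructor
    · rintro ⟨g, rfl⟩; exact ⟨fun i => g i, fun i => (g i).2, rfl⟩
    · rintro ⟨g, h, rfl⟩; exact ⟨fun i => ⟨g i, h i⟩, rfl⟩
  rw [← hr]
  refine ⟨inferInstance, ?_⟩
  rw [LinearMap.finrank_range_of_inj he, Module.finrank_pi_fintype]
  simp

/-- infinitesimal lift giving the derivation -/
noncomputable def Kum.inf0 (d : ℕ) (a : R) (δ : Derivation k R R) :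
    R →ₐ[k] TrivSqZeroExt (Kum d a) (Kum d a) where
  toFun r := TrivSqZeroExt.inl (Kum.o d a r) + TrivSqZeroExt.inr (Kum.o d a (d * a * δ r))
  map_one' := by ext <;> simp
  map_zero' := by ext <;> simp
  map_add' x y := by ext <;> simp [mul_add]
  map_mul' x y := by
    ext
    · simp
    · simp; ring
  commutes' r := by
    ext
    · simp; rfl
    · simp; rfl

noncomputable def Kum.inf (d : ℕ) (hd : 0 < d) (a : R) (δ : Derivation k R R) :
    Kum d a →ₐ[k] TrivSqZeroExt (Kum d a) (Kum d a) :=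
  AdjoinRoot.liftAlgHom _ (Kum.inf0 d a δ)
    (TrivSqZeroExt.inl (Kum.z d a) + TrivSqZeroExt.inr (Kum.o d a (δ a) * Kum.z d a)) (by
    have hz := Kum.z_pow d a
    rw [eval₂_sub, eval₂_X_pow, eval₂_C, sub_eq_zero]
    ext
    · simp [Kum.inf0, hz]
    · obtain ⟨n, rfl⟩ : ∃ n, d = n + 1 := ⟨d - 1, by omega⟩
      simp [Kum.inf0, TrivSqZeroExt.snd_pow, ← hz]
      ring)

lemma Kum.inf_fst (d : ℕ) (hd : 0 < d) (a : R) (δ : Derivation k R R) (x : Kum d a) :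
    (Kum.inf d hd a δ x).fst = x := by
  have : ((TrivSqZeroExt.fstHom k (Kum d a) (Kum d a)).comp (Kum.inf d hd a δ)) = AlgHom.id k _ := by
    apply AdjoinRoot.algHom_ext'
    · ext r; simp [Kum.inf, Kum.inf0]
    · simp [Kum.inf]
  exact congrArg (fun φ : Kum d a →ₐ[k] Kum d a => φ x) this

noncomputable def Kum.der (d : ℕ) (hd : 0 < d) (a : R) (δ : Derivation k R R) :
    Derivation k (Kum d a) (Kum d a) :=
  Derivation.mk' ((TrivSqZeroExt.sndHom (Kum d a) (Kum d a)).restrictScalars k ∘ₗ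
    (Kum.inf d hd a δ).toLinearMap) (by
    intro x y
    simp [Kum.inf_fst, mul_comm])

lemma Kum.der_o (d : ℕ) (hd : 0 < d) (a : R) (δ : Derivation k R R) (x : R) :
    Kum.der d hd a δ (Kum.o d a x) = Kum.o d a (d * a * δ x) := by
  simp [Kum.der, Kum.inf, Kum.inf0]

lemma Kum.der_z (d : ℕ) (hd : 0 < d) (a : R) (δ : Derivation k R R) :
    Kum.der d hd a δ (Kum.z d a) = Kum.o d a (δ a) * Kum.z d a := by
  simp [Kum.der, Kum.inf, Kum.inf0]

lemma Kum.der_z_pow (d : ℕ) (hd : 0 < d) (a : R) (δ : Derivation k R R) (i : ℕ) :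
    Kum.der d hd a δ (Kum.z d a ^ i) = Kum.o d a (i * δ a) * Kum.z d a ^ i := by
  induction i with
  | zero => simp
  | succ i ih =>
    rw [pow_succ, Derivation.leibniz, ih, Kum.der_z, smul_eq_mul, smul_eq_mul]
    simp only [map_mul, Nat.cast_succ, map_add, map_one, map_natCast]
    ring

lemma Kum.der_mono (d : ℕ) (hd : 0 < d) (a : R) (δ : Derivation k R R) (g : R) (i : ℕ) :
    Kum.der d hd a δ (Kum.o d a g * Kum.z d a ^ i) =
      Kum.o d a ((d : k) • (a * δ g) + (i : k) • (δ a * g)) * Kum.z d a ^ i := by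
  rw [Derivation.leibniz, Kum.der_z_pow, Kum.der_o, smul_eq_mul, smul_eq_mul]
  simp only [map_mul, map_add, map_natCast, Nat.cast_smul_eq_nsmul, nsmul_eq_mul]
  ring

lemma Kum.WW_mono (d : ℕ) (a : R) {W W' : Submodule k R} (h : W ≤ W') :
    Kum.WW d a W ≤ Kum.WW d a W' := by
  intro x hx
  rw [Kum.mem_WW] at hx ⊢
  obtain ⟨g, hg, rfl⟩ := hx
  exact ⟨g, fun i => h (hg i), rfl⟩

lemma Kum.finHom (d : ℕ) (a : R) (h : Finite (R →ₐ[k] k)) (hk : Finite k) :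
    Finite (Kum d a →ₐ[k] k) := by
  refine Finite.of_injective (β := (R →ₐ[k] k) × k)
    (fun P => (P.comp (AdjoinRoot.ofAlgHom k _), P (Kum.z d a))) ?_
  intro P Q h
  simp only [Prod.mk.injEq] at h
  exact AdjoinRoot.algHom_ext' h.1 h.2

/-- extension of a package by a `d`-th root -/
noncomputable def Pkg.ext [Nontrivial R] {D s e : ℕ} (pk : Pkg k R D s e) (hk : Finite k)
    (d : ℕ) (hd : 0 < d) (a : R)
    (ha : a ∈ pk.W 1) : Pkg k (Kum d a) (d * D) (2 * s + 1) (e + s + 1) where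
  W n := Kum.WW d a (pk.W n)
  mono m n h := Kum.WW_mono d a (pk.mono h)
  fin n := by have := pk.fin n; exact (Kum.finrank_WW d hd a (pk.W n)).1
  rank n := by
    have := pk.fin n
    rw [(Kum.finrank_WW d hd a (pk.W n)).2, pk.rank]; ring
  exh x := by
    obtain ⟨g, rfl⟩ := Kum.ex_coord d hd a x
    choose N hN using fun i => pk.exh (g i)
    refine ⟨Finset.univ.sup N, ?_⟩
    rw [Kum.mem_WW]
    exact ⟨g, fun i => pk.mono (Finset.le_sup (Finset.mem_univ i)) (hN i), rfl⟩
  one := by simpa using Kum.mono_mem d a (pk.W 0) 1 pk.one 0 hd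
  mul := by
    intro m n x y hx hy
    rw [Kum.mem_WW] at hx hy
    obtain ⟨g, hg, rfl⟩ := hx
    obtain ⟨h, hh, rfl⟩ := hy
    rw [Finset.sum_mul_sum]
    refine Submodule.sum_mem _ fun i _ => Submodule.sum_mem _ fun j _ => ?_
    have hgh := pk.mul _ _ _ _ (hg i) (hh j)
    have e1 : Kum.o d a (g i) * Kum.z d a ^ (i : ℕ) * (Kum.o d a (h j) * Kum.z d a ^ (j : ℕ)) =
      Kum.o d a (g i * h j) * Kum.z d a ^ (i + j : ℕ) := by rw [map_mul, pow_add]; ring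
    rw [e1]
    by_cases hij : (i + j : ℕ) < d
    · exact Kum.mono_mem d a _ _ (pk.mono (by omega) hgh) _ hij
    · have e2 : Kum.z d a ^ (i + j : ℕ) = Kum.o d a a * Kum.z d a ^ (i + j - d : ℕ) := by
        rw [← Kum.z_pow, ← pow_add]; congr 1; omega
      rw [e2, ← mul_assoc, ← map_mul]
      refine Kum.mono_mem d a _ _ (pk.mono ?_ (pk.mul _ _ _ _ hgh ha)) _ (by omega)
      omega
  δ := Kum.der d hd a pk.δ
  hδ := by
    intro n x hx
    rw [Kum.mem_WW] at hx
    obtain ⟨g, hg, rfl⟩ := hx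
    rw [map_sum]
    refine Submodule.sum_mem _ fun i _ => ?_
    rw [Kum.der_mono]
    refine Kum.mono_mem d a _ _ (Submodule.add_mem _ (Submodule.smul_mem _ _ ?_)
      (Submodule.smul_mem _ _ ?_)) _ i.2
    · exact pk.mono (by omega) (pk.mul _ _ _ _ ha (pk.hδ _ _ (hg i)))
    · exact pk.mono (by omega) (pk.mul _ _ _ _ (pk.hδ _ _ ha) (hg i))
  t := Kum.o d a pk.t
  finHom := Kum.finHom d a pk.finHom hk

lemma Pkg.base_mem (n : ℕ) (p : k[X]) : p ∈ degreeLT k (n+1) ↔ p.natDegree ≤ n := by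
  rw [mem_degreeLT]
  by_cases hp : p = 0
  · simp [hp]
  · rw [degree_eq_natDegree hp, Nat.cast_lt, Nat.lt_succ_iff]

/-- the rational function field package -/
noncomputable def Pkg.base (k : Type u) [Field k] (hk : Finite k) : Pkg k k[X] 1 0 0 where
  W n := degreeLT k (n + 1)
  mono m n h := degreeLT_mono (by omega)
  fin n := by
    exact Module.Finite.equiv (degreeLTEquiv k (n+1)).symm
  rank n := by
    rw [(degreeLTEquiv k (n+1)).finrank_eq]; simp
  exh x := ⟨x.natDegree, by rw [Pkg.base_mem]⟩
  one := by rw [Pkg.base_mem]; simp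
  mul := by
    intro a b x y hx hy
    rw [Pkg.base_mem] at *
    exact natDegree_mul_le.trans (by omega)
  δ := derivative'
  hδ := by
    intro n x hx
    rw [Pkg.base_mem] at *
    exact (natDegree_derivative_le x).trans (by omega)
  t := X
  finHom := by
    refine Finite.of_injective (β := k) (fun P => P X) ?_
    intro P Q h
    exact Polynomial.algHom_ext h

/-- lifting of homomorphisms -/
noncomputable def Kum.lift {A : Type*} [CommRing A] [Algebra k A] (d : ℕ) (a : R) (P : R →ₐ[k] A)
    (y : A) (h : y ^ d = P a) : Kum d a →ₐ[k] A :=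
  AdjoinRoot.liftAlgHom _ P y (by
    rw [eval₂_sub, eval₂_X_pow, eval₂_C, sub_eq_zero]; exact h)

lemma Kum.lift_o {A : Type*} [CommRing A] [Algebra k A] (d : ℕ) (a : R) (P : R →ₐ[k] A)
    (y : A) (h : y ^ d = P a) (x : R) : Kum.lift d a P y h (Kum.o d a x) = P x := by
  simp [Kum.lift]

lemma Kum.lift_z {A : Type*} [CommRing A] [Algebra k A] (d : ℕ) (a : R) (P : R →ₐ[k] A)
    (y : A) (h : y ^ d = P a) : Kum.lift d a P y h (Kum.z d a) = y := by
  simp [Kum.lift]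

end Ext

section PS
variable {k : Type u} [Field k] {R : Type u} [CommRing R] [Algebra k R]
variable {F : Type u} [Field F] [Algebra k F]

lemma ps_root (d : ℕ) (hd : (d : F) ≠ 0) (u : PowerSeries F) (y0 : F) (h0 : y0 ≠ 0)
    (h : y0 ^ d = PowerSeries.constantCoeff u) :
    ∃ y : PowerSeries F, y ^ d = u ∧ PowerSeries.constantCoeff y = y0 := by
  have hd0 : d ≠ 0 := by rintro rfl; simp at hd
  obtain ⟨y, hy, hy'⟩ := HenselianRing.is_henselian (I := Ideal.span {(PowerSeries.X : PowerSeries F)})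
    (X ^ d - C u) (monic_X_pow_sub_C u hd0) (PowerSeries.C y0) (by
      rw [Ideal.mem_span_singleton, PowerSeries.X_dvd_iff]
      simp [h]) (by
      apply IsUnit.map
      rw [PowerSeries.isUnit_iff_constantCoeff]
      rw [derivative_sub, derivative_C, sub_zero, derivative_X_pow]
      simp [hd, h0])
  refine ⟨y, ?_, ?_⟩
  · simpa [sub_eq_zero, IsRoot] using hy
  · rw [Ideal.mem_span_singleton, PowerSeries.X_dvd_iff] at hy'
    simpa [sub_eq_zero] using hy'

lemma ps_root_coeff (d : ℕ) (u y : PowerSeries F) (h : y ^ d = u)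
    (hu : PowerSeries.coeff 1 u ≠ 0) : PowerSeries.coeff 1 y ≠ 0 := by
  intro h1
  apply hu
  rw [← h]
  clear h hu
  induction d with
  | zero => simp
  | succ n ih =>
    rw [pow_succ, PowerSeries.coeff_mul, Finset.Nat.antidiagonal_succ]
    simp [h1, ih]

lemma ps_pow_indep (w : PowerSeries F) (h0 : PowerSeries.constantCoeff w = 0)
    (h1 : w ≠ 0) : LinearIndependent k (fun i : ℕ => w ^ i) := by
  suffices H : ∀ p : k[X], aeval w p = 0 → p = 0 by
    have := (Polynomial.basisMonomials k).linearIndependent.map' (aeval (R := k) w).toLinearMap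
      (LinearMap.ker_eq_bot'.2 H)
    simpa [Function.comp_def, aeval_monomial] using this
  intro p
  induction hn : p.natDegree using Nat.strong_induction_on generalizing p with
  | _ n ih =>
  intro hp
  have e := Polynomial.divX_mul_X_add p
  have hc : p.coeff 0 = 0 := by
    have := congrArg PowerSeries.constantCoeff hp
    rw [← e] at this
    simp [h0, PowerSeries.algebraMap_apply] at this
    simpa using this
  rw [hc, map_zero, add_zero] at e
  by_contra hne
  have hX : p.divX ≠ 0 := by rintro h; rw [h] at e; simp at e; exact hne e.symm
  apply hX
  refine ih (p.divX.natDegree) ?_ p.divX rfl ?_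
  · have : p.natDegree = p.divX.natDegree + 1 := by
      conv_lhs => rw [← e]
      exact natDegree_mul_X hX
    omega
  · rw [← e] at hp
    simpa [h1] using hp

lemma ps_inj {D s e : ℕ} [IsDomain R] (pk : Pkg k R D s e) (φ : R →ₐ[k] PowerSeries F) (u : R)
    (h0 : PowerSeries.constantCoeff (φ u) = 0) (h1 : PowerSeries.coeff 1 (φ u) ≠ 0) :
    Function.Injective φ := by
  rw [injective_iff_map_eq_zero]
  intro f hf
  by_contra hne
  obtain ⟨n, hn⟩ := pk.exh f
  have hw : φ u ≠ 0 := by intro h; simp [h] at h1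
  have := pk.codim (n := n) (f := f) (V := PowerSeries F) φ.toLinearMap hne hn
    (fun g => by simp [hf]) (ι := Fin (D * (n + s) + 1)) (fun i => u ^ (i : ℕ)) (by
      have := (ps_pow_indep (k := k) (φ u) h0 hw).comp (fun i : Fin (D * (n + s) + 1) => (i : ℕ))
        Fin.val_injective
      simpa [Function.comp_def] using this)
  simp at this

lemma ps_irr (d : ℕ) (hd : 0 < d) (w : PowerSeries F)
    (h0 : PowerSeries.constantCoeff w = 0) (h1 : PowerSeries.coeff 1 w ≠ 0) :
    IsDomain (Kum d w) := by
  have hm : (X ^ d - C w : (PowerSeries F)[X]).Monic := monic_X_pow_sub_C w hd.ne'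
  have hdeg : (X ^ d - C w : (PowerSeries F)[X]).natDegree = d := natDegree_X_pow_sub_C
  have hirr : Irreducible (X ^ d - C w : (PowerSeries F)[X]) := by
    refine IsEisensteinAt.irreducible (𝓟 := Ideal.span {(PowerSeries.X : PowerSeries F)})
      ?_ PowerSeries.span_X_isPrime hm.isPrimitive (by omega)
    refine ⟨?_, ?_, ?_⟩
    · rw [hm.leadingCoeff]
      intro h
      rw [Ideal.mem_span_singleton, PowerSeries.X_dvd_iff] at h
      simp at h
    · intro n hn
      rw [hdeg] at hn
      rw [coeff_sub, coeff_X_pow, if_neg hn.ne, coeff_C]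
      split_ifs
      · rw [Ideal.mem_span_singleton, PowerSeries.X_dvd_iff]
        simp [h0]
      · simp
    · rw [coeff_sub, coeff_X_pow, if_neg hd.ne, coeff_C_zero, Ideal.span_singleton_pow,
        Ideal.mem_span_singleton, PowerSeries.X_pow_dvd_iff]
      intro h
      have := h 1 (by norm_num)
      apply h1
      simpa using this
  exact AdjoinRoot.isDomain_of_prime hirr.prime

lemma kum_domain [IsDomain R] (d : ℕ) (hd : 0 < d) (a : R) (φ : R →ₐ[k] PowerSeries F)
    (hφ : Function.Injective φ)
    (h0 : PowerSeries.constantCoeff (φ a) = 0) (h1 : PowerSeries.coeff 1 (φ a) ≠ 0) :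
    IsDomain (Kum d a) := by
  have := ps_irr d hd (φ a) h0 h1
  let Q : R →ₐ[k] Kum d (φ a) := (AdjoinRoot.ofAlgHom k (X ^ d - C (φ a))).comp φ
  let ψ : Kum d a →ₐ[k] Kum d (φ a) := Kum.lift d a Q (Kum.z d (φ a)) (Kum.z_pow d (φ a))
  have hψ : Function.Injective ψ := by
    rw [injective_iff_map_eq_zero]
    intro x hx
    obtain ⟨g, rfl⟩ := Kum.ex_coord d hd a x
    have h2 := Kum.coord_inj d hd (φ a) (fun i => φ (g i)) (by
      rw [← hx, map_sum]
      refine Finset.sum_congr rfl fun i _ => ?_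
      have e1 : ψ (Kum.o d a (g i)) = Kum.o d (φ a) (φ (g i)) := Kum.lift_o d a Q _ _ _
      have e2 : ψ (Kum.z d a) = Kum.z d (φ a) := Kum.lift_z d a Q _ _
      rw [map_mul, map_pow, e1, e2])
    refine Finset.sum_eq_zero fun i _ => ?_
    have : g i = 0 := hφ (by rw [map_zero]; exact congrFun h2 i)
    rw [this, map_zero, zero_mul]
  exact hψ.isDomain ψ.toRingHom

end PS

section BranchInv
variable {k : Type u} [Field k] {R : Type u} [CommRing R] [Algebra k R]
variable {F : Type u} [Field F] [Algebra k F]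

/-- forward orbit of the critical value -/
def orb (d : ℕ) (c : k) (i : ℕ) : k := (fun z => z ^ d + c)^[i] c

lemma orb_zero (d : ℕ) (c : k) : orb d c 0 = c := rfl
lemma orb_succ (d : ℕ) (c : k) (i : ℕ) : orb d c (i + 1) = orb d c i ^ d + c := by
  simp only [orb, Function.iterate_succ_apply']

/-- the wandering hypothesis up to level `N` -/
def Wand (d : ℕ) (c : k) (N : ℕ) : Prop :=
  (∀ i j, i ≤ N → j ≤ N → orb d c i = orb d c j → i = j) ∧ ∀ i ≤ N, orb d c i ≠ 0

variable (F) in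
/-- the branch condition -/
def BrInv (d : ℕ) (c : k) (M : Multiset (R × ℕ)) : Prop :=
  ∀ w n M', M = (w, n) ::ₘ M' → ∀ i ≤ n, ∃ φ : R →ₐ[k] PowerSeries F,
    PowerSeries.constantCoeff (φ w) = algebraMap k F (orb d c i) ∧
    PowerSeries.coeff 1 (φ w) ≠ 0 ∧
    ∀ v m, (v, m) ∈ M' → ∀ a ≤ m,
      PowerSeries.constantCoeff (φ v) ≠ algebraMap k F (orb d c a)

/-- radicand -/
def rad (b c : k) (w : R) : R := algebraMap k R b * (w - algebraMap k R c)

/-- transport to the extension -/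
noncomputable def up (d : ℕ) (a : R) (M : Multiset (R × ℕ)) : Multiset (Kum d a × ℕ) :=
  M.map (fun p => (Kum.o d a p.1, p.2))

/-- the new branches -/
noncomputable def kids (k : Type u) [Field k] [Algebra k R] (d : ℕ) (a : R) (n : ℕ) :
    Multiset (Kum d a × ℕ) :=
  (nthRootsFinset d (1 : k)).val.map (fun η => (algebraMap k (Kum d a) η * Kum.z d a, n))

lemma ps_const_alg (x : k) :
    PowerSeries.constantCoeff (algebraMap k (PowerSeries F) x) = algebraMap k F x := by
  simp [PowerSeries.algebraMap_apply]

lemma ps_coeff_alg (x : k) :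
    PowerSeries.coeff 1 (algebraMap k (PowerSeries F) x) = 0 := by
  simp [PowerSeries.algebraMap_apply]

lemma ps_const_rad (b c : k) (w : R) (φ : R →ₐ[k] PowerSeries F) :
    PowerSeries.constantCoeff (φ (rad b c w)) =
      algebraMap k F b * (PowerSeries.constantCoeff (φ w) - algebraMap k F c) := by
  simp [rad, ps_const_alg]

lemma ps_coeff_rad (b c : k) (w : R) (φ : R →ₐ[k] PowerSeries F) :
    PowerSeries.coeff 1 (φ (rad b c w)) =
      algebraMap k F b * PowerSeries.coeff 1 (φ w) := by
  rw [rad, map_mul, AlgHom.commutes, ← Algebra.smul_def, map_sub, AlgHom.commutes,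
    PowerSeries.algebraMap_apply, Algebra.smul_def, PowerSeries.algebraMap_apply,
    PowerSeries.coeff_C_mul]
  simp

lemma ext_hom (d : ℕ) (hd : (d : F) ≠ 0) (a : R) (φ : R →ₐ[k] PowerSeries F) (y0 : F) (h0 : y0 ≠ 0)
    (h : y0 ^ d = PowerSeries.constantCoeff (φ a)) :
    ∃ ψ : Kum d a →ₐ[k] PowerSeries F, (∀ x, ψ (Kum.o d a x) = φ x) ∧
      PowerSeries.constantCoeff (ψ (Kum.z d a)) = y0 ∧
      (PowerSeries.coeff 1 (φ a) ≠ 0 → PowerSeries.coeff 1 (ψ (Kum.z d a)) ≠ 0) := by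
  obtain ⟨y, hy, hy0⟩ := ps_root d hd (φ a) y0 h0 h
  refine ⟨Kum.lift d a φ y hy, Kum.lift_o d a φ y hy, ?_, ?_⟩
  · rw [Kum.lift_z, hy0]
  · intro h1
    rw [Kum.lift_z]; exact ps_root_coeff d _ y hy h1

lemma inv_old [IsAlgClosed F] (d : ℕ) (hd : (d : F) ≠ 0) (c b : k) (hb : b ≠ 0)
    (w : R) (n : ℕ) (tl : Multiset (R × ℕ)) (hI : BrInv F d c ((w, n + 1) ::ₘ tl))
    (v : R) (m : ℕ) (tl' : Multiset (R × ℕ)) (htl : tl = (v, m) ::ₘ tl') (i : ℕ) (hi : i ≤ m) :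
    ∃ ψ : Kum d (rad b c w) →ₐ[k] PowerSeries F,
      PowerSeries.constantCoeff (ψ (Kum.o d _ v)) = algebraMap k F (orb d c i) ∧
      PowerSeries.coeff 1 (ψ (Kum.o d _ v)) ≠ 0 ∧
      (∀ v' m', (v', m') ∈ up d (rad b c w) tl' → ∀ a ≤ m',
        PowerSeries.constantCoeff (ψ v') ≠ algebraMap k F (orb d c a)) ∧
      (∀ a ≤ n, b = 1 → PowerSeries.constantCoeff (ψ (Kum.z d _)) ^ d ≠
        algebraMap k F (orb d c a) ^ d) := by
  have hd0 : d ≠ 0 := by rintro rfl; simp at hd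
  obtain ⟨φ, h1, h2, h3⟩ := hI v m ((w, n + 1) ::ₘ tl') (by rw [htl, Multiset.cons_swap]) i hi
  have hw := h3 w (n + 1) (Multiset.mem_cons_self _ _)
  obtain ⟨y0, hy0⟩ := IsAlgClosed.exists_pow_nat_eq
    (PowerSeries.constantCoeff (φ (rad b c w))) (Nat.pos_of_ne_zero hd0)
  have hne : PowerSeries.constantCoeff (φ (rad b c w)) ≠ 0 := by
    rw [ps_const_rad]
    refine mul_ne_zero (by simpa using hb) (sub_ne_zero.2 ?_)
    simpa [orb_zero] using hw 0 (by omega)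
  have hy : y0 ≠ 0 := by rintro rfl; rw [zero_pow hd0] at hy0; exact hne hy0.symm
  obtain ⟨ψ, g1, g2, g3⟩ := ext_hom d hd _ φ y0 hy hy0
  refine ⟨ψ, by rw [g1, h1], by rw [g1]; exact h2, ?_, ?_⟩
  · intro v' m' hv a ha
    obtain ⟨p, hp, hp'⟩ := Multiset.mem_map.1 hv
    simp only [Prod.mk.injEq] at hp'
    rw [← hp'.1, g1]
    exact h3 p.1 p.2 (Multiset.mem_cons_of_mem hp) a (hp'.2 ▸ ha)
  · intro a ha hb1 he
    rw [g2, hy0, ps_const_rad, hb1, map_one, one_mul, sub_eq_iff_eq_add] at he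
    apply hw (a + 1) (by omega)
    rw [he, orb_succ]; simp

lemma inv_twist [IsAlgClosed F] (d : ℕ) (hd : (d : F) ≠ 0) (c b : k) (hb : b ≠ 0)
    (w : R) (n : ℕ) (tl : Multiset (R × ℕ)) (hI : BrInv F d c ((w, n + 1) ::ₘ tl)) :
    BrInv F d c (up d (rad b c w) tl) := by
  intro w' n' M' hM i hi
  have hmem : (w', n') ∈ up d (rad b c w) tl := by rw [hM]; exact Multiset.mem_cons_self _ _
  obtain ⟨p, hp, hp'⟩ := Multiset.mem_map.1 hmem
  obtain ⟨v, m⟩ := p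
  obtain ⟨tl', htl'⟩ := Multiset.exists_cons_of_mem hp
  simp only [Prod.mk.injEq] at hp'
  obtain ⟨rfl, rfl⟩ := hp'
  obtain ⟨ψ, h1, h2, h3, h4⟩ := inv_old d hd c b hb w n tl hI v m tl' htl' i hi
  refine ⟨ψ, h1, h2, ?_⟩
  have : M' = up d (rad b c w) tl' := by
    rw [htl'] at hM
    simp only [up, Multiset.map_cons] at hM
    exact ((Multiset.cons_inj_right _).1 hM).symm
  rw [this]; exact h3

lemma inv_kids [IsAlgClosed F] (d : ℕ) (hd : (d : F) ≠ 0) (c : k)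
    (w : R) (n : ℕ) (hW : Wand d c (n + 1))
    (tl : Multiset (R × ℕ)) (hI : BrInv F d c ((w, n + 1) ::ₘ tl)) :
    BrInv F d c (kids k d (rad 1 c w) n + up d (rad 1 c w) tl) := by
  classical
  have hd0 : d ≠ 0 := by rintro rfl; simp at hd
  have hdp := Nat.pos_of_ne_zero hd0
  intro w' n' M' hM i hi
  have hmem : (w', n') ∈ kids k d (rad 1 c w) n + up d (rad 1 c w) tl := by
    rw [hM]; exact Multiset.mem_cons_self _ _
  rw [Multiset.mem_add] at hmem
  rcases hmem with hmem | hmem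
  · obtain ⟨η, hη, hp'⟩ := Multiset.mem_map.1 hmem
    simp only [Prod.mk.injEq] at hp'
    obtain ⟨rfl, rfl⟩ := hp'
    have hη1 : η ^ d = 1 := (mem_nthRootsFinset hdp _).1 hη
    have hη0 : η ≠ 0 := by rintro rfl; simp [hd0] at hη1
    have hM' : M' = ((nthRootsFinset d (1 : k)).erase η).val.map
        (fun η => (algebraMap k (Kum d (rad 1 c w)) η * Kum.z d (rad 1 c w), n)) +
        up d (rad 1 c w) tl := by
      have e1 : (nthRootsFinset d (1 : k)).val = η ::ₘ ((nthRootsFinset d (1 : k)).erase η).val := by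
        rw [Finset.erase_val, Multiset.cons_erase hη]
      rw [kids, e1, Multiset.map_cons, Multiset.cons_add] at hM
      exact ((Multiset.cons_inj_right _).1 hM).symm
    obtain ⟨φ, h1, h2, h3⟩ := hI w (n + 1) tl rfl (i + 1) (by omega)
    have hoi : orb d c i ≠ 0 := hW.2 i (by omega)
    obtain ⟨ψ, g1, g2, g3⟩ := ext_hom d hd (rad 1 c w) φ (algebraMap k F (η⁻¹ * orb d c i))
      (by simp [hη0, hoi]) (by
        rw [ps_const_rad, h1, orb_succ, ← map_pow, mul_pow, inv_pow, hη1]; simp)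
    have g3 := g3 (by rw [ps_coeff_rad]; simpa using h2)
    refine ⟨ψ, ?_, ?_, ?_⟩
    · rw [map_mul, AlgHom.commutes, map_mul, ps_const_alg, g2, ← map_mul]
      congr 1; field_simp
    · rw [map_mul, AlgHom.commutes, PowerSeries.algebraMap_apply, PowerSeries.coeff_C_mul]
      exact mul_ne_zero (by simpa using hη0) g3
    · intro v m hv a ha he
      rw [hM', Multiset.mem_add] at hv
      rcases hv with hv | hv
      · obtain ⟨θ, hθ, hp'⟩ := Multiset.mem_map.1 hv
        simp only [Prod.mk.injEq] at hp'
        obtain ⟨rfl, rfl⟩ := hp'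
        have hθ' : θ ∈ (nthRootsFinset d (1 : k)).erase η := hθ
        rw [Finset.mem_erase, mem_nthRootsFinset hdp] at hθ'
        rw [map_mul, AlgHom.commutes, map_mul, ps_const_alg, g2, ← map_mul] at he
        have he' := (algebraMap k F).injective he
        have : orb d c (i + 1) = orb d c (a + 1) := by
          rw [orb_succ, orb_succ, ← he', mul_pow, mul_pow, inv_pow, hη1, hθ'.2]; simp
        have := hW.1 _ _ (by omega) (by omega) this
        have hia : i = a := by omega
        subst hia
        apply hθ'.1
        field_simp at he'
        exact he'
      · obtain ⟨p, hp, hp'⟩ := Multiset.mem_map.1 hv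
        simp only [Prod.mk.injEq] at hp'
        rw [← hp'.1, g1] at he
        exact h3 p.1 p.2 hp a (hp'.2 ▸ ha) he
  · obtain ⟨p, hp, hp'⟩ := Multiset.mem_map.1 hmem
    obtain ⟨v, m⟩ := p
    obtain ⟨tl', htl'⟩ := Multiset.exists_cons_of_mem hp
    simp only [Prod.mk.injEq] at hp'
    obtain ⟨rfl, rfl⟩ := hp'
    obtain ⟨ψ, h1, h2, h3, h4⟩ := inv_old d hd c 1 one_ne_zero w n tl hI v m tl' htl' i hi
    refine ⟨ψ, h1, h2, ?_⟩
    have hM' : M' = kids k d (rad 1 c w) n + up d (rad 1 c w) tl' := by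
      rw [htl'] at hM
      simp only [up, Multiset.map_cons, Multiset.add_cons] at hM
      exact ((Multiset.cons_inj_right _).1 hM).symm
    intro v' m' hv a ha he
    rw [hM', Multiset.mem_add] at hv
    rcases hv with hv | hv
    · obtain ⟨θ, hθ, hp'⟩ := Multiset.mem_map.1 hv
      simp only [Prod.mk.injEq] at hp'
      obtain ⟨rfl, rfl⟩ := hp'
      have hθ' : θ ∈ nthRootsFinset d (1 : k) := hθ
      rw [mem_nthRootsFinset hdp] at hθ'
      apply h4 a ha rfl
      rw [← he, map_mul, AlgHom.commutes, map_mul, ps_const_alg, mul_pow, ← map_pow (algebraMap k F), hθ']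
      simp
    · exact h3 v' m' hv a ha he

lemma inv_base (d : ℕ) (c : k) (n : ℕ) : BrInv F d c ({((X : k[X]), n)} : Multiset (k[X] × ℕ)) := by
  intro w n' M' hM i hi
  rw [← Multiset.cons_zero, Multiset.cons_eq_cons] at hM
  have hM : ((X : k[X]), n) = (w, n') ∧ 0 = M' := by
    rcases hM with h | ⟨_, cs, h, _⟩
    · exact h
    · exact absurd h (Multiset.zero_ne_cons)
  obtain ⟨h, rfl⟩ := hM
  simp only [Prod.mk.injEq] at h
  obtain ⟨rfl, rfl⟩ := h
  refine ⟨aeval (PowerSeries.C (algebraMap k F (orb d c i)) + PowerSeries.X), ?_, ?_, ?_⟩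
  · simp
  · simp [PowerSeries.coeff_C]
  · simp

lemma inv_domain {D s e : ℕ} [IsDomain R] (pk : Pkg k R D s e) (d : ℕ) (hd : 0 < d) (c b : k)
    (hb : b ≠ 0) (w : R) (n : ℕ) (tl : Multiset (R × ℕ)) (hI : BrInv F d c ((w, n) ::ₘ tl)) :
    IsDomain (Kum d (rad b c w)) ∧ rad b c w ≠ 0 := by
  obtain ⟨φ, h1, h2, h3⟩ := hI w n tl rfl 0 (by omega)
  have e0 : PowerSeries.constantCoeff (φ (rad b c w)) = 0 := by
    rw [ps_const_rad, h1, orb_zero]; simp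
  have e1 : PowerSeries.coeff 1 (φ (rad b c w)) ≠ 0 := by
    rw [ps_coeff_rad]; exact mul_ne_zero (by simpa using hb) h2
  refine ⟨kum_domain d hd _ φ (ps_inj pk φ _ e0 e1) e0 e1, ?_⟩
  intro h
  rw [h] at e1; simp at e1

end BranchInv

section Count
variable {k : Type u} [Field k] {R : Type u} [CommRing R] [Algebra k R] {D s e : ℕ}

/-- image of the `n`-th iterate -/
def img (d : ℕ) (c : k) (n : ℕ) : Set k := Set.range ((fun z => z ^ d + c)^[n])

lemma mem_img_succ (d : ℕ) (c : k) (n : ℕ) (x : k) :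
    x ∈ img d c (n + 1) ↔ ∃ y ∈ img d c n, y ^ d + c = x := by
  constructor
  · rintro ⟨u, rfl⟩
    exact ⟨_, ⟨u, rfl⟩, by rw [Function.iterate_succ_apply']⟩
  · rintro ⟨y, ⟨u, rfl⟩, rfl⟩
    exact ⟨u, by rw [Function.iterate_succ_apply']⟩

/-- the good points for which some branch value is an iterated image -/
def Ev (pk : Pkg k R D s e) (d : ℕ) (c : k) (M : Multiset (R × ℕ)) : Set (R →ₐ[k] k) :=
  {P | P (pk.δ pk.t) ≠ 0 ∧ ∃ p ∈ M, P p.1 ∈ img d c p.2}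

lemma lift_count [Finite k] [Finite (R →ₐ[k] k)]
    (d : ℕ) (hd : 0 < d) (ζ : k) (hζ : IsPrimitiveRoot ζ d) (a : R)
    (A : Set (R →ₐ[k] k)) (A' : Set (Kum d a →ₐ[k] k))
    (h1 : ∀ P ∈ A, P a ≠ 0 ∧ ∃ y, y ^ d = P a)
    (h2 : ∀ P ∈ A, ∀ Q : Kum d a →ₐ[k] k, (∀ x, Q (Kum.o d a x) = P x) → Q ∈ A') :
    d * A.ncard ≤ A'.ncard := by
  have := Kum.finHom (k := k) d a inferInstance inferInstance
  classical
  choose! y hy using fun P hP => (h1 P hP).2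
  let Z : Set k := ↑(nthRootsFinset d (1 : k))
  have hZ : Z.ncard = d := by
    rw [Set.ncard_coe_finset, hζ.card_nthRootsFinset]
  have hmemZ : ∀ η, η ∈ Z ↔ η ^ d = 1 := fun η => by
    simp only [Z, Finset.mem_coe, mem_nthRootsFinset hd]
  have hcard : d * A.ncard = (Z ×ˢ A).ncard := by rw [Set.ncard_prod, hZ]
  rw [hcard]
  have hex : ∀ p : k × (R →ₐ[k] k), p ∈ Z ×ˢ A → ∃ Q : Kum d a →ₐ[k] k,
      (∀ x, Q (Kum.o d a x) = p.2 x) ∧ Q (Kum.z d a) = p.1 * y p.2 := by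
    rintro ⟨η, P⟩ ⟨h, hP⟩
    have h : (η * y P) ^ d = P a := by rw [mul_pow, (hmemZ η).1 h, one_mul, hy P hP]
    exact ⟨Kum.lift d a P _ h, Kum.lift_o d a P _ h, Kum.lift_z d a P _ h⟩
  have : Nonempty (Kum d a →ₐ[k] k) ∨ A = ∅ := by
    by_contra hcon
    push Not at hcon
    obtain ⟨P, hP⟩ := hcon.2
    obtain ⟨Q, -⟩ := hex (1, P) ⟨(hmemZ 1).2 (one_pow d), hP⟩
    exact hcon.1.elim Q
  rcases this with _ | rfl
  swap
  · simp
  choose! g hg1 hg2 using hex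
  refine Set.ncard_le_ncard_of_injOn g ?_ ?_ (Set.toFinite _)
  · intro p hp
    exact h2 p.2 hp.2 _ (hg1 p hp)
  · intro p hp p' hp' he
    have e1 : p.2 = p'.2 := by
      ext x; rw [← hg1 p hp, ← hg1 p' hp', he]
    have e2 : p.1 * y p.2 = p'.1 * y p'.2 := by rw [← hg2 p hp, ← hg2 p' hp', he]
    have hy0 : y p.2 ≠ 0 := by
      intro h0
      have := hy p.2 hp.2
      rw [h0, zero_pow hd.ne'] at this
      exact (h1 p.2 hp.2).1 this.symm
    rw [← e1] at e2
    exact Prod.ext (mul_right_cancel₀ hy0 e2) e1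

lemma exists_twist [Finite k] (d : ℕ) (hd : 0 < d) :
    ∃ g : k, g ≠ 0 ∧ ∀ x : k, x ≠ 0 → ∃ i < d, ∃ y, y ^ d = g ^ i * x := by
  obtain ⟨g, hg⟩ := IsCyclic.exists_generator (α := kˣ)
  refine ⟨g, g.ne_zero, fun x hx => ?_⟩
  have hpos : 0 < orderOf g := orderOf_pos g
  obtain ⟨m, hm⟩ := (mem_powers_iff_mem_zpowers.2 (hg (Units.mk0 x hx)) : _)
  have hm' : (g : k) ^ m = x := by
    have := congrArg Units.val hm
    simpa using this
  refine ⟨(d - m % d) % d, Nat.mod_lt _ hd, (g : k) ^ (((d - m % d) % d + m) / d), ?_⟩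
  rw [← hm', ← pow_add, ← pow_mul, Nat.div_mul_cancel]
  rw [Nat.dvd_iff_mod_eq_zero, Nat.mod_add_mod, Nat.add_mod]
  have h3 := Nat.mod_lt m hd
  rw [← Nat.add_mod]
  have h4 : d - m % d + m = d * (m / d + 1) := by
    have := Nat.div_add_mod m d
    rw [mul_add]; omega
  rw [h4]; simp

lemma rad_mem (pk : Pkg k R D s e) (b c : k) (w : R) (hw : w ∈ pk.W 1) : rad b c w ∈ pk.W 1 := by
  rw [rad, ← Algebra.smul_def, Algebra.algebraMap_eq_smul_one]
  exact Submodule.smul_mem _ _ (Submodule.sub_mem _ hw (Submodule.smul_mem _ _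
    (pk.mono (by omega) pk.one)))

lemma zero_bound [IsDomain R] (pk : Pkg k R D s e) (f : R) (hf : f ≠ 0) (hfW : f ∈ pk.W 1) :
    Set.ncard {P : R →ₐ[k] k | P (pk.δ pk.t) ≠ 0 ∧ P f = 0} ≤ D * (1 + s) := by
  classical
  have := pk.finHom
  have hfi := Set.toFinite {P : R →ₐ[k] k | P (pk.δ pk.t) ≠ 0 ∧ P f = 0}
  rw [Set.ncard_eq_toFinset_card _ hfi]
  have := pk.zero_count hfi.toFinset (fun P hP => ((Set.Finite.mem_toFinset _).1 hP).1) hf hfW 1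
    (fun j h1 h2 => by omega) (by
      intro P hP
      apply mem_van_of_derivs
      intro j hj
      have : j = 0 := by omega
      subst this
      exact ((Set.Finite.mem_toFinset _).1 hP).2)
  simpa using this

end Count

section Step
variable {k : Type u} [Field k] {R : Type u} [CommRing R] [Algebra k R] {D s e : ℕ}

lemma good_lift [Nontrivial R] (pk : Pkg k R D s e) (hk : Finite k) (d : ℕ) (hd : 0 < d)
    (hdk : (d : k) ≠ 0) (a : R) (ha : a ∈ pk.W 1) (P : R →ₐ[k] k) (hP : P (pk.δ pk.t) ≠ 0)
    (hPa : P a ≠ 0) (Q : Kum d a →ₐ[k] k) (hQ : ∀ x, Q (Kum.o d a x) = P x) :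
    Q ((pk.ext hk d hd a ha).δ (pk.ext hk d hd a ha).t) ≠ 0 := by
  have h : (pk.ext hk d hd a ha).δ (pk.ext hk d hd a ha).t = Kum.o d a (d * a * pk.δ pk.t) :=
    Kum.der_o d hd a pk.δ pk.t
  rw [h, hQ]
  simp [hdk, hPa, hP]

lemma step_count [IsDomain R] (pk : Pkg k R D s e) (hk : Finite k)
    (d : ℕ) (hd : 0 < d) (hdk : (d : k) ≠ 0) (ζ : k) (hζ : IsPrimitiveRoot ζ d) (c : k)
    (w : R) (n : ℕ) (tl : Multiset (R × ℕ)) (hw : w ∈ pk.W 1) (hrad : rad 1 c w ≠ 0)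
    (g : k) (hg : g ≠ 0) (htw : ∀ x : k, x ≠ 0 → ∃ i < d, ∃ y, y ^ d = g ^ i * x) :
    d * (Ev pk d c ((w, n + 1) ::ₘ tl)).ncard ≤ d * (D * (1 + s)) +
      (Ev (pk.ext hk d hd (rad 1 c w) (rad_mem pk 1 c w hw)) d c
        (kids k d (rad 1 c w) n + up d (rad 1 c w) tl)).ncard +
      ∑ i ∈ Finset.Ico 1 d, (Ev (pk.ext hk d hd (rad (g ^ i) c w) (rad_mem pk (g ^ i) c w hw)) d c
        (up d (rad (g ^ i) c w) tl)).ncard := by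
  classical
  have := pk.finHom
  have hPr : ∀ (P : R →ₐ[k] k) (b : k), P (rad b c w) = b * (P w - c) := fun P b => by
    simp [rad]
  let A0 : Set (R →ₐ[k] k) := {P | P (pk.δ pk.t) ≠ 0 ∧ P (rad 1 c w) = 0}
  let A1 : Set (R →ₐ[k] k) := {P | P ∈ Ev pk d c ((w, n + 1) ::ₘ tl) ∧ P w - c ≠ 0 ∧
    ∃ y, y ^ d = P w - c}
  let A : ℕ → Set (R →ₐ[k] k) := fun i => {P | P ∈ Ev pk d c tl ∧ P w - c ≠ 0 ∧
    ∃ y, y ^ d = g ^ i * (P w - c)}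
  have hcover : Ev pk d c ((w, n + 1) ::ₘ tl) ⊆ (A0 ∪ A1) ∪ ⋃ i ∈ Finset.Ico 1 d, A i := by
    intro P hP
    by_cases h0 : P w - c = 0
    · left; left; exact ⟨hP.1, by rw [hPr, h0, mul_zero]⟩
    by_cases h1 : ∃ y, y ^ d = P w - c
    · left; right; exact ⟨hP, h0, h1⟩
    right
    obtain ⟨i, hi, y, hy⟩ := htw _ h0
    simp only [Set.mem_iUnion]
    refine ⟨i, ?_, ?_, h0, y, hy⟩
    · rw [Finset.mem_Ico]
      refine ⟨?_, hi⟩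
      by_contra hcon
      have : i = 0 := by omega
      subst this
      exact h1 ⟨y, by simpa using hy⟩
    · obtain ⟨hP1, p, hp, hp'⟩ := hP
      refine ⟨hP1, p, ?_, hp'⟩
      rcases Multiset.mem_cons.1 hp with rfl | hp
      · exfalso
        obtain ⟨y', -, hy'⟩ := (mem_img_succ d c n _).1 hp'
        exact h1 ⟨y', by rw [← hy']; ring⟩
      · exact hp
  have hA0 : A0.ncard ≤ D * (1 + s) := zero_bound pk _ hrad (rad_mem pk 1 c w hw)
  have hup : ∀ (b : k) (P : R →ₐ[k] k) (Q : Kum d (rad b c w) →ₐ[k] k),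
      (∀ x, Q (Kum.o d _ x) = P x) → (∃ p ∈ tl, P p.1 ∈ img d c p.2) →
      ∃ p ∈ up d (rad b c w) tl, Q p.1 ∈ img d c p.2 := by
    rintro b P Q hQ ⟨p, hp, hp'⟩
    exact ⟨(Kum.o d _ p.1, p.2), Multiset.mem_map.2 ⟨p, hp, rfl⟩, by rw [hQ]; exact hp'⟩
  have hA1 : d * A1.ncard ≤ (Ev (pk.ext hk d hd (rad 1 c w) (rad_mem pk 1 c w hw)) d c
        (kids k d (rad 1 c w) n + up d (rad 1 c w) tl)).ncard := by
    refine lift_count d hd ζ hζ _ _ _ ?_ ?_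
    · rintro P ⟨-, h1, h2⟩
      rw [hPr, one_mul]; exact ⟨h1, h2⟩
    · rintro P ⟨⟨hP1, p, hp, hp'⟩, h1, h2⟩ Q hQ
      refine ⟨good_lift pk hk d hd hdk _ _ P hP1 (by rw [hPr, one_mul]; exact h1) Q hQ, ?_⟩
      rcases Multiset.mem_cons.1 hp with rfl | hp
      · obtain ⟨y, hyi, hy⟩ := (mem_img_succ d c n _).1 hp'
        have hz : Q (Kum.z d _) ^ d = y ^ d := by
          rw [← map_pow, Kum.z_pow, hQ, hPr, one_mul]
          simp only at hy
          rw [← hy]; ring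
        have hz0 : Q (Kum.z d (rad 1 c w)) ≠ 0 := by
          intro h0
          rw [h0, zero_pow hd.ne'] at hz
          apply h1
          simp only at hy
          rw [← hy, ← hz]; ring
        refine ⟨(algebraMap k _ (y / Q (Kum.z d (rad 1 c w))) * Kum.z d _, n), ?_, ?_⟩
        · rw [Multiset.mem_add]; left
          refine Multiset.mem_map.2 ⟨y / Q (Kum.z d (rad 1 c w)), ?_, rfl⟩
          rw [Finset.mem_val, mem_nthRootsFinset hd, div_pow, ← hz, div_self]
          exact pow_ne_zero _ hz0
        · simp only [map_mul, AlgHom.commutes, Algebra.algebraMap_self, RingHom.id_apply]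
          rw [div_mul_cancel₀ _ hz0]; exact hyi
      · obtain ⟨p', hp1, hp2⟩ := hup 1 P Q hQ ⟨p, hp, hp'⟩
        exact ⟨p', Multiset.mem_add.2 (Or.inr hp1), hp2⟩
  have hA : ∀ i, d * (A i).ncard ≤
      (Ev (pk.ext hk d hd (rad (g ^ i) c w) (rad_mem pk (g ^ i) c w hw)) d c
        (up d (rad (g ^ i) c w) tl)).ncard := by
    intro i
    refine lift_count d hd ζ hζ _ _ _ ?_ ?_
    · rintro P ⟨-, h1, h2⟩
      rw [hPr]; exact ⟨mul_ne_zero (pow_ne_zero _ hg) h1, h2⟩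
    · rintro P ⟨⟨hP1, h⟩, h1, h2⟩ Q hQ
      exact ⟨good_lift pk hk d hd hdk _ _ P hP1
        (by rw [hPr]; exact mul_ne_zero (pow_ne_zero _ hg) h1) Q hQ, hup _ P Q hQ h⟩
  have hU : (⋃ i ∈ Finset.Ico 1 d, A i).ncard ≤ ∑ i ∈ Finset.Ico 1 d, (A i).ncard :=
    Finset.set_ncard_biUnion_le _ _
  have htot : (Ev pk d c ((w, n + 1) ::ₘ tl)).ncard ≤
      A0.ncard + A1.ncard + ∑ i ∈ Finset.Ico 1 d, (A i).ncard :=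
    (Set.ncard_le_ncard hcover (Set.toFinite _)).trans
      ((Set.ncard_union_le _ _).trans (add_le_add (Set.ncard_union_le _ _) hU))
  calc _ ≤ d * (A0.ncard + A1.ncard + ∑ i ∈ Finset.Ico 1 d, (A i).ncard) := Nat.mul_le_mul_left _ htot
    _ = d * A0.ncard + d * A1.ncard + ∑ i ∈ Finset.Ico 1 d, d * (A i).ncard := by
      rw [mul_add, mul_add, Finset.mul_sum]
    _ ≤ _ := add_le_add (add_le_add (Nat.mul_le_mul_left _ hA0) hA1)
      (Finset.sum_le_sum fun i _ => hA i)

/-- limiting densities -/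
noncomputable def gam (d : ℕ) : ℕ → ℝ
  | 0 => 0
  | n + 1 => ((d : ℝ) - 1 + gam d n ^ d) / d

/-- the inductive statement -/
def Bound.{v} (d N : ℕ) (ns : Multiset ℕ) : Prop :=
  ∀ D s e : ℕ, 0 < D → ∃ C : ℕ, ∀ (k : Type v) [Field k] [Finite k] (R : Type v) [CommRing R]
    [Algebra k R] [IsDomain R] (pk : Pkg k R D s e) (c ζ : k) (M : Multiset (R × ℕ)),
    IsPrimitiveRoot ζ d → (d : k) ≠ 0 → (∀ j : ℕ, 0 < j → j ≤ C → (j : k) ≠ 0) → Wand d c N →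
    M.map Prod.snd = ns → (∀ p ∈ M, p.1 ∈ pk.W 1) → BrInv (AlgebraicClosure k) d c M →
    ((Ev pk d c M).ncard : ℝ) ≤ 2 * Nat.card k * (1 - (ns.map (gam d)).prod) + C

lemma bound_nil (d N : ℕ) : Bound.{u} d N 0 := by
  intro D s e hD
  refine ⟨0, ?_⟩
  intro k _ _ R _ _ _ pk c ζ M _ _ _ _ hM _ _
  rw [Multiset.map_eq_zero] at hM
  subst hM
  simp [Ev]

lemma bound_zero (d N : ℕ) (ns : Multiset ℕ) (h0 : 0 ∈ ns) : Bound.{u} d N ns := by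
  intro D s e hD
  obtain ⟨μ, hμ⟩ : ∃ μ, μ = s + 1 := ⟨_, rfl⟩
  obtain ⟨Q, hQ⟩ : ∃ Q, Q = D * μ := ⟨_, rfl⟩
  obtain ⟨l, hl⟩ : ∃ l, l = Q * (Q * e + μ + s) := ⟨_, rfl⟩
  obtain ⟨C, hC⟩ : ∃ C, C = l + 2 * s + D * (μ + s) + Q + D * (l + s) + 2 := ⟨_, rfl⟩
  refine ⟨C, ?_⟩
  intro k _ _ R _ _ _ pk c ζ M _ _ hp _ hM _ _
  classical
  have := pk.finHom
  have := Fintype.ofFinite k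
  have hfi := Set.toFinite (Ev pk d c M)
  have h := stepanov hD pk μ Q l C hμ hQ hl hC hp hfi.toFinset
    (fun P hP => ((Set.Finite.mem_toFinset _).1 hP).1)
  rw [Set.ncard_eq_toFinset_card _ hfi, Nat.card_eq_fintype_card]
  have hprod : (ns.map (gam d)).prod = 0 :=
    Multiset.prod_eq_zero (Multiset.mem_map.2 ⟨0, h0, rfl⟩)
  rw [hprod]
  have h' : (hfi.toFinset.card : ℝ) ≤ ((2 * Fintype.card k + C : ℕ) : ℝ) := Nat.cast_le.2 h
  push_cast at h' ⊢
  linarith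

lemma snd_up (d : ℕ) (a : R) (M : Multiset (R × ℕ)) :
    (up d a M).map Prod.snd = M.map Prod.snd := by
  simp [up, Multiset.map_map]

lemma snd_kids (d : ℕ) (a : R) (n : ℕ) (ζ : k) (hζ : IsPrimitiveRoot ζ d) :
    (kids k d a n).map Prod.snd = Multiset.replicate d n := by
  have : Multiset.card (nthRootsFinset d (1 : k)).val = d := hζ.card_nthRootsFinset
  simp [kids, Multiset.map_map, this]

lemma mem_up_W [Nontrivial R] (pk : Pkg k R D s e) (hk : Finite k) (d : ℕ) (hd : 0 < d) (a : R)
    (ha : a ∈ pk.W 1) (M : Multiset (R × ℕ)) (hM : ∀ p ∈ M, p.1 ∈ pk.W 1) :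
    ∀ p ∈ up d a M, p.1 ∈ (pk.ext hk d hd a ha).W 1 := by
  intro p hp
  obtain ⟨p', hp', rfl⟩ := Multiset.mem_map.1 hp
  have := Kum.mono_mem d a (pk.W 1) p'.1 (hM p' hp') 0 hd
  rw [pow_zero, mul_one] at this
  exact this

lemma mem_kids_W [Nontrivial R] (pk : Pkg k R D s e) (hk : Finite k) (d : ℕ) (hd : 0 < d)
    (hd2 : 2 ≤ d) (a : R) (ha : a ∈ pk.W 1) (n : ℕ) :
    ∀ p ∈ kids k d a n, p.1 ∈ (pk.ext hk d hd a ha).W 1 := by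
  intro p hp
  obtain ⟨η, -, rfl⟩ := Multiset.mem_map.1 hp
  have := Kum.mono_mem d a (pk.W 1) (algebraMap k R η) (by
    rw [Algebra.algebraMap_eq_smul_one]
    exact Submodule.smul_mem _ _ (pk.mono (by omega) pk.one)) 1 (by omega)
  rw [pow_one] at this
  exact this

lemma bound_step (d N : ℕ) (hd2 : 2 ≤ d) (n : ℕ) (hn : n + 1 ≤ N) (ns : Multiset ℕ)
    (h1 : Bound.{u} d N (Multiset.replicate d n + ns)) (h2 : Bound.{u} d N ns) :
    Bound.{u} d N ((n + 1) ::ₘ ns) := by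
  intro D s e hD
  have hd : 0 < d := by omega
  obtain ⟨C1, hC1⟩ := h1 (d * D) (2 * s + 1) (e + s + 1) (by positivity)
  obtain ⟨C2, hC2⟩ := h2 (d * D) (2 * s + 1) (e + s + 1) (by positivity)
  refine ⟨D * (1 + s) + C1 + C2, ?_⟩
  intro k _ hk R _ _ _ pk c ζ M hζ hdk hp hW hM hMW hI
  have hmem : n + 1 ∈ M.map Prod.snd := by rw [hM]; exact Multiset.mem_cons_self _ _
  obtain ⟨⟨w, n'⟩, hwM, hn'⟩ := Multiset.mem_map.1 hmem
  simp only at hn'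
  subst hn'
  obtain ⟨tl, rfl⟩ := Multiset.exists_cons_of_mem hwM
  rw [Multiset.map_cons, Multiset.cons_inj_right] at hM
  have hw : w ∈ pk.W 1 := hMW _ (Multiset.mem_cons_self _ _)
  have htl : ∀ p ∈ tl, p.1 ∈ pk.W 1 := fun p hp => hMW p (Multiset.mem_cons_of_mem hp)
  have hdF : (d : AlgebraicClosure k) ≠ 0 := by
    rw [← map_natCast (algebraMap k (AlgebraicClosure k)) d]
    exact (_root_.map_ne_zero _).2 hdk
  obtain ⟨g, hg, htw⟩ := exists_twist (k := k) d hd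
  have hWn : Wand d c (n + 1) := ⟨fun i j hi hj => hW.1 i j (hi.trans hn) (hj.trans hn),
    fun i hi => hW.2 i (hi.trans hn)⟩
  have hstep := step_count pk hk d hd hdk ζ hζ c w n tl hw
    (inv_domain pk d hd c 1 one_ne_zero w _ tl hI).2 g hg htw
  have := (inv_domain pk d hd c 1 one_ne_zero w _ tl hI).1
  have b1 := hC1 k (Kum d (rad 1 c w)) (pk.ext hk d hd (rad 1 c w) (rad_mem pk 1 c w hw)) c ζ
    (kids k d (rad 1 c w) n + up d (rad 1 c w) tl) hζ hdk (fun j h1 h2 => hp j h1 (by omega)) hW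
    (by rw [Multiset.map_add, snd_up, snd_kids d _ n ζ hζ, hM])
    (by
      intro p hp
      rcases Multiset.mem_add.1 hp with hp | hp
      · exact mem_kids_W pk hk d hd hd2 _ _ n p hp
      · exact mem_up_W pk hk d hd _ _ tl htl p hp)
    (inv_kids d hdF c w n hWn tl hI)
  have b2 : ∀ i, ((Ev (pk.ext hk d hd (rad (g ^ i) c w) (rad_mem pk (g ^ i) c w hw)) d c
        (up d (rad (g ^ i) c w) tl)).ncard : ℝ) ≤
        2 * Nat.card k * (1 - (ns.map (gam d)).prod) + C2 := by
    intro i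
    have := (inv_domain pk d hd c (g ^ i) (pow_ne_zero _ hg) w _ tl hI).1
    exact hC2 k (Kum d (rad (g ^ i) c w)) _ c ζ (up d (rad (g ^ i) c w) tl) hζ hdk
      (fun j h1 h2 => hp j h1 (by omega)) hW (by rw [snd_up, hM])
      (mem_up_W pk hk d hd _ _ tl htl)
      (inv_twist d hdF c _ (pow_ne_zero _ hg) w n tl hI)
  have hstep' : (d : ℝ) * (Ev pk d c ((w, n + 1) ::ₘ tl)).ncard ≤ d * (D * (1 + s)) +
      (Ev (pk.ext hk d hd (rad 1 c w) (rad_mem pk 1 c w hw)) d c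
        (kids k d (rad 1 c w) n + up d (rad 1 c w) tl)).ncard +
      ∑ i ∈ Finset.Ico 1 d, ((Ev (pk.ext hk d hd (rad (g ^ i) c w)
        (rad_mem pk (g ^ i) c w hw)) d c (up d (rad (g ^ i) c w) tl)).ncard : ℝ) := by
    exact_mod_cast hstep
  have hsum := Finset.sum_le_sum (s := Finset.Ico 1 d) fun i _ => b2 i
  rw [Finset.sum_const, Nat.card_Ico, nsmul_eq_mul, Nat.cast_sub (by omega : 1 ≤ d)] at hsum
  rw [Multiset.map_cons, Multiset.prod_cons]
  rw [Multiset.map_add, Multiset.prod_add, Multiset.map_replicate, Multiset.prod_replicate] at b1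
  set T := (ns.map (gam d)).prod
  set q : ℝ := (Nat.card k : ℝ)
  have hdR : (0 : ℝ) < d := by exact_mod_cast hd
  have hg1 : gam d (n + 1) * d = (d : ℝ) - 1 + gam d n ^ d := by
    simp only [gam]; field_simp
  push_cast at hsum ⊢
  have hc1 : (0 : ℝ) ≤ C1 := Nat.cast_nonneg _
  have hc2 : (0 : ℝ) ≤ C2 := Nat.cast_nonneg _
  have hd1 : (1 : ℝ) ≤ d := by exact_mod_cast hd
  have hmain : (d : ℝ) * (Ev pk d c ((w, n + 1) ::ₘ tl)).ncard ≤
      d * (2 * q * (1 - gam d (n + 1) * T) + (D * (1 + s) + C1 + C2)) := by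
    refine hstep'.trans ((add_le_add (add_le_add le_rfl b1) hsum).trans ?_)
    have e1 : (d : ℝ) * (2 * q * (1 - gam d (n + 1) * T) + (D * (1 + s) + C1 + C2)) =
      2 * q * (d - (gam d (n + 1) * d) * T) + d * (D * (1 + s)) + d * C1 + d * C2 := by ring
    rw [e1, hg1]
    nlinarith [mul_nonneg hc1 (sub_nonneg.2 hd1)]
  exact le_of_mul_le_mul_left hmain hdR

lemma bound_all (d N : ℕ) (hd2 : 2 ≤ d) (ns : Multiset ℕ) (hN : ∀ n ∈ ns, n ≤ N) :
    Bound.{u} d N ns := by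
  induction hm : (ns.map (fun n => (d + 1) ^ n)).sum using Nat.strong_induction_on
    generalizing ns with
  | _ m ih =>
  by_cases h0 : 0 ∈ ns
  · exact bound_zero d N ns h0
  rcases Multiset.empty_or_exists_mem ns with rfl | ⟨n, hn⟩
  · exact bound_nil d N
  obtain ⟨n, rfl⟩ : ∃ n', n = n' + 1 := ⟨n - 1, by
    rcases n with _ | n
    · exact absurd hn h0
    · simp⟩
  obtain ⟨tl, rfl⟩ := Multiset.exists_cons_of_mem hn
  have hpos : 0 < (d + 1) ^ n := by positivity
  rw [Multiset.map_cons, Multiset.sum_cons, pow_succ] at hm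
  refine bound_step d N hd2 n (hN _ hn) tl (ih _ ?_ _ ?_ rfl) (ih _ ?_ _ ?_ rfl)
  · rw [Multiset.map_add, Multiset.sum_add, Multiset.map_replicate, Multiset.sum_replicate,
      smul_eq_mul, ← hm]
    nlinarith
  · intro n' hn'
    rcases Multiset.mem_add.1 hn' with h | h
    · rw [Multiset.eq_of_mem_replicate h]
      have := hN _ hn
      omega
    · exact hN _ (Multiset.mem_cons_of_mem h)
  · rw [← hm]; nlinarith
  · exact fun n' h => hN _ (Multiset.mem_cons_of_mem h)

/-- bound for the image of an iterate -/
theorem img_bound (d n : ℕ) (hd2 : 2 ≤ d) : ∃ C : ℕ, ∀ (k : Type u) [Field k] [Finite k] (c ζ : k),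
    IsPrimitiveRoot ζ d → (d : k) ≠ 0 → (∀ j : ℕ, 0 < j → j ≤ C → (j : k) ≠ 0) → Wand d c n →
    ((img d c n).ncard : ℝ) ≤ 2 * Nat.card k * (1 - gam d n) + C := by
  obtain ⟨C, hC⟩ := bound_all.{u} d n hd2 {n} (by simp) 1 0 0 one_pos
  refine ⟨C, ?_⟩
  intro k _ hk c ζ hζ hdk hp hW
  have h := hC k k[X] (Pkg.base k hk) c ζ {(X, n)} hζ hdk hp hW (by simp) (by
    intro p hp
    rw [Multiset.mem_singleton] at hp
    subst hp
    change X ∈ degreeLT k (1 + 1)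
    rw [Pkg.base_mem]; simp) (inv_base d c n)
  rw [Multiset.map_singleton, Multiset.prod_singleton] at h
  refine le_trans ?_ h
  have := (Pkg.base k hk).finHom
  rw [Nat.cast_le]
  refine Set.ncard_le_ncard_of_injOn (fun x => aeval x) ?_ ?_ (Set.toFinite _)
  · intro x hx
    refine ⟨?_, (X, n), Multiset.mem_singleton_self _, by simpa using hx⟩
    have : (Pkg.base k hk).δ (Pkg.base k hk).t = 1 := by
      change derivative' (X : k[X]) = 1
      simp
    rw [this]; simp
  · intro x _ y _ h
    have := congrArg (fun P : k[X] →ₐ[k] k => P X) h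
    simpa using this

end Step

section Final

lemma bern (x : ℝ) (h0 : 0 ≤ x) (h1 : x ≤ 1) (d : ℕ) :
    1 - x ^ (d + 2) ≤ (1 - x) * ((d + 2 : ℕ) - 1 + x) := by
  induction d with
  | zero => push_cast; nlinarith
  | succ d ih =>
    have h2 : x ^ (d + 2) ≤ 1 := pow_le_one₀ h0 h1
    have h3 : 1 - x ^ (d + 1 + 2) = (1 - x ^ (d + 2)) + x ^ (d + 2) * (1 - x) := by ring
    rw [h3]
    push_cast at ih ⊢
    nlinarith [mul_nonneg (sub_nonneg.2 h2) (sub_nonneg.2 h1)]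

lemma gam_mem (d : ℕ) (hd : 2 ≤ d) (n : ℕ) : 0 ≤ gam d n ∧ gam d n ≤ 1 := by
  have hd' : (2 : ℝ) ≤ d := by exact_mod_cast hd
  induction n with
  | zero => simp [gam]
  | succ n ih =>
    have h1 : gam d n ^ d ≤ 1 := pow_le_one₀ ih.1 ih.2
    have h2 : 0 ≤ gam d n ^ d := pow_nonneg ih.1 _
    simp only [gam]
    constructor
    · apply div_nonneg <;> linarith
    · rw [div_le_one (by linarith)]; linarith

lemma gam_close (d : ℕ) (hd : 2 ≤ d) (ε : ℝ) (hε : 0 < ε) : ∃ n, 1 - gam d n ≤ ε := by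
  by_contra! hcon
  have hd' : (2 : ℝ) ≤ d := by exact_mod_cast hd
  have hε1 : ε < 1 := by simpa [gam] using hcon 0
  have hr0 : 0 ≤ 1 - ε / d := by
    rw [sub_nonneg, div_le_one (by linarith)]; linarith
  have key : ∀ n, 1 - gam d n ≤ (1 - ε / d) ^ n := by
    intro n
    induction n with
    | zero => simp [gam]
    | succ n ih =>
      obtain ⟨h0, h1⟩ := gam_mem d hd n
      have hb := bern (gam d n) h0 h1 (d - 2)
      rw [show d - 2 + 2 = d by omega] at hb
      have h2 := hcon n
      have e1 : 1 - gam d (n + 1) = (1 - gam d n ^ d) / d := by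
        simp only [gam]; field_simp; ring
      have h3 : 1 - gam d n ^ d ≤ (1 - gam d n) * (d - ε) :=
        hb.trans (mul_le_mul_of_nonneg_left (by linarith) (by linarith))
      calc 1 - gam d (n + 1) ≤ (1 - gam d n) * (d - ε) / d := by
            rw [e1]; exact div_le_div_of_nonneg_right h3 (by linarith)
        _ = (1 - gam d n) * (1 - ε / d) := by field_simp
        _ ≤ (1 - ε / d) ^ n * (1 - ε / d) := mul_le_mul_of_nonneg_right ih hr0
        _ = _ := by rw [pow_succ]
  obtain ⟨n, hn⟩ := exists_pow_lt_of_lt_one hε (show 1 - ε / d < 1 by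
    have : 0 < ε / d := by positivity
    linarith)
  linarith [key n, hcon n]

lemma avoid {K : Type u} [Field K] [NumberField K] (T : Finset (𝓞 K)) (hT : ∀ x ∈ T, x ≠ 0) :
    ∃ M : ℕ, ∀ 𝔭 : Ideal (𝓞 K), M < Ideal.absNorm 𝔭 → ∀ x ∈ T, x ∉ 𝔭 := by
  refine ⟨Ideal.absNorm (Ideal.span {∏ x ∈ T, x}), fun 𝔭 h x hx hmem => ?_⟩
  have h1 : Ideal.span {∏ x ∈ T, x} ≤ 𝔭 := by
    rw [Ideal.span_singleton_le_iff_mem]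
    exact Ideal.mem_of_dvd _ (Finset.dvd_prod_of_mem _ hx) hmem
  have h2 := Ideal.absNorm_dvd_absNorm_of_le h1
  have h3 : Ideal.absNorm (Ideal.span {∏ x ∈ T, x}) ≠ 0 := by
    rw [Ne, Ideal.absNorm_eq_zero_iff, Ideal.span_singleton_eq_bot, Finset.prod_eq_zero_iff]
    rintro ⟨y, hy, hy0⟩
    exact hT y hy hy0
  exact absurd (Nat.le_of_dvd (Nat.pos_of_ne_zero h3) h2) (by omega)

lemma per_sub_img {k : Type u} [Field k] (d : ℕ) (c : k) (n : ℕ) (z : k) (m : ℕ) (hm : 0 < m)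
    (h : (fun w => w ^ d + c)^[m] z = z) : z ∈ img d c n := by
  refine ⟨(fun w => w ^ d + c)^[m * n - n] z, ?_⟩
  rw [← Function.iterate_add_apply]
  have : n + (m * n - n) = m * n := by
    have : n ≤ m * n := Nat.le_mul_of_pos_left n hm
    omega
  rw [this, Function.iterate_mul]
  exact Function.iterate_fixed h n

lemma orb_eq {k : Type u} [Field k] (d : ℕ) (hd : 0 < d) (c : k) (i : ℕ) :
    orb d c i = (fun w => w ^ d + c)^[i + 1] 0 := by
  rw [Function.iterate_succ_apply]
  simp [orb, hd.ne']

theorem main_red {K : Type u} [Field K] [NumberField K]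
    (d : ℕ) (hd : 2 ≤ d) (ζ : K) (hζ : IsPrimitiveRoot ζ d)
    (c : 𝓞 K) (f : Polynomial (𝓞 K)) (hf : f = X ^ d + C c)
    (hwander : ∀ m n : ℕ, n < m → (fun z => f.eval z)^[m] 0 ≠ (fun z => f.eval z)^[n] 0) (n : ℕ) :
    ∃ B M : ℕ, ∀ 𝔭 : Ideal (𝓞 K), 𝔭.IsPrime → 𝔭 ≠ ⊥ → M < Ideal.absNorm 𝔭 →
      (perCount f 𝔭 : ℝ) ≤ 2 * (Ideal.absNorm 𝔭 : ℝ) * (1 - gam d n) + B := by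
  classical
  obtain ⟨B, hB⟩ := img_bound.{u} d n hd
  have : NeZero d := ⟨by omega⟩
  have hζ' := hζ.toInteger_isPrimitiveRoot
  set ξ := hζ.toInteger
  let F : 𝓞 K → 𝓞 K := fun z => f.eval z
  have hF : F = fun z => z ^ d + c := by funext z; simp [F, hf]
  let T : Finset (𝓞 K) := (((Finset.Icc 1 B).image (fun j : ℕ => (j : 𝓞 K))) ∪ {(d : 𝓞 K)}) ∪
    (((Finset.range (n + 2) ×ˢ Finset.range (n + 2)).filter (fun p => p.2 < p.1)).image
      (fun p => F^[p.1] 0 - F^[p.2] 0)) ∪ ((Finset.Ico 1 d).image (fun i => ξ ^ i - 1))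
  obtain ⟨M, hM⟩ := avoid T (by
    intro x hx
    simp only [T, Finset.mem_union, Finset.mem_image, Finset.mem_filter, Finset.mem_singleton] at hx
    rcases hx with ((⟨j, hj, rfl⟩ | rfl) | ⟨p, hp, rfl⟩) | ⟨i, hi, rfl⟩
    · rw [Finset.mem_Icc] at hj
      exact Nat.cast_ne_zero.2 (by omega)
    · exact Nat.cast_ne_zero.2 (by omega)
    · exact sub_ne_zero.2 (hwander _ _ hp.2)
    · rw [Finset.mem_Ico] at hi
      exact sub_ne_zero.2 (hζ'.pow_ne_one_of_pos_of_lt (by omega) hi.2))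
  refine ⟨B, M, fun 𝔭 hp hbot hlt => ?_⟩
  have hmem := hM 𝔭 hlt
  have : 𝔭.IsMaximal := hp.isMaximal hbot
  letI := Ideal.Quotient.field 𝔭
  have : Finite (𝓞 K ⧸ 𝔭) := Ideal.finiteQuotientOfFreeOfNeBot 𝔭 hbot
  let π := Ideal.Quotient.mk 𝔭
  have hne : ∀ x, x ∈ T → π x ≠ 0 := fun x hx h0 =>
    hmem x hx (Ideal.Quotient.eq_zero_iff_mem.1 h0)
  have hsemi : Function.Semiconj π F (fun w => w ^ d + π c) := by
    intro z; rw [hF]; simp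
  have hit : ∀ i, π (F^[i] 0) = (fun w => w ^ d + π c)^[i] 0 := by
    intro i
    have := (hsemi.iterate_right i).eq 0
    rw [this, map_zero]
  have hlt' : ∀ i j, j < i → i ≤ n + 1 →
      (fun w => w ^ d + π c)^[i] 0 ≠ (fun w => w ^ d + π c)^[j] (0 : 𝓞 K ⧸ 𝔭) := by
    intro i j hji hi h
    apply hne (F^[i] 0 - F^[j] 0)
    · simp only [T, Finset.mem_union, Finset.mem_image, Finset.mem_filter]
      left; right
      exact ⟨(i, j), ⟨Finset.mem_product.2 ⟨Finset.mem_range.2 (by omega),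
        Finset.mem_range.2 (by omega)⟩, hji⟩, rfl⟩
    · rw [map_sub, hit, hit, h, sub_self]
  have hdp : 0 < d := by omega
  have hb := hB (𝓞 K ⧸ 𝔭) (π c) (π ξ)
    (by
      refine IsPrimitiveRoot.mk_of_lt _ hdp ?_ ?_
      · rw [← map_pow, hζ'.pow_eq_one, map_one]
      · intro l h1 h2 h
        apply hne (ξ ^ l - 1)
        · simp only [T, Finset.mem_union, Finset.mem_image]
          right
          exact ⟨l, Finset.mem_Ico.2 ⟨h1, h2⟩, rfl⟩
        · rw [map_sub, map_pow, h, map_one, sub_self])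
    (by
      have := hne (d : 𝓞 K) (by simp [T])
      rwa [map_natCast] at this)
    (by
      intro j h1 h2
      have := hne (j : 𝓞 K) (by
        simp only [T, Finset.mem_union, Finset.mem_image]
        left; left; left
        exact ⟨j, Finset.mem_Icc.2 ⟨h1, h2⟩, rfl⟩)
      rwa [map_natCast] at this)
    (by
      constructor
      · intro i j hi hj h
        rw [orb_eq d hdp, orb_eq d hdp] at h
        rcases lt_trichotomy i j with hij | hij | hij
        · exact absurd h.symm (hlt' _ _ (by omega) (by omega))
        · exact hij
        · exact absurd h (hlt' _ _ (by omega) (by omega))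
      · intro i hi h
        rw [orb_eq d hdp] at h
        exact hlt' (i + 1) 0 (by omega) (by omega) (by simpa using h))
  have hcard : Nat.card (𝓞 K ⧸ 𝔭) = Ideal.absNorm 𝔭 := by
    rw [Ideal.absNorm_apply, Submodule.cardQuot_apply]
  rw [hcard] at hb
  refine le_trans ?_ hb
  rw [Nat.cast_le, perCount]
  refine Set.ncard_le_ncard ?_ (Set.toFinite _)
  rintro z ⟨m, hm, h⟩
  refine per_sub_img d (π c) n z m hm ?_
  have : (fun w => (f.map (Ideal.Quotient.mk 𝔭)).eval w) = fun w => w ^ d + π c := by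
    funext w; simp [hf, π]
  rw [this] at h
  exact h

end Final

/-- For `f(x) = x^d + c` over `𝓞_K`, `d ≥ 2`, where `K` contains a
primitive `d`-th root of unity and `0` is not preperiodic under `f`, the proportion
`#Per(f_𝔭)/(N(𝔭)+1)` tends to `0` as `N(𝔭) → ∞`. -/
theorem unicritical_limit_zero_of_root_of_unity {K : Type*} [Field K] [NumberField K]
    (d : ℕ) (hd : 2 ≤ d) (ζ : K) (hζ : IsPrimitiveRoot ζ d)
    (c : 𝓞 K) (f : Polynomial (𝓞 K)) (hf : f = X ^ d + C c)
    (hwander : ∀ m n : ℕ, n < m → (fun z => f.eval z)^[m] 0 ≠ (fun z => f.eval z)^[n] 0) :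
    ∀ ε : ℝ, 0 < ε → ∃ M : ℝ,
      ∀ 𝔭 : Ideal (𝓞 K), 𝔭.IsPrime → 𝔭 ≠ ⊥ → M < (Ideal.absNorm 𝔭 : ℝ) →
        (perCount f 𝔭 : ℝ) ≤ ε * ((Ideal.absNorm 𝔭 : ℝ) + 1) := by
  intro ε hε
  obtain ⟨n, hn⟩ := gam_close d hd (ε / 4) (by positivity)
  obtain ⟨B, M, h⟩ := main_red d hd ζ hζ c f hf hwander n
  refine ⟨max M (2 * B / ε), fun 𝔭 hp hbot hlt => ?_⟩
  rw [max_lt_iff] at hlt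
  refine (h 𝔭 hp hbot (by exact_mod_cast hlt.1)).trans ?_
  have h2 := hlt.2
  rw [div_lt_iff₀ hε] at h2
  have hN : (0 : ℝ) ≤ (Ideal.absNorm 𝔭 : ℝ) := Nat.cast_nonneg _
  nlinarith [mul_le_mul_of_nonneg_left hn hN]
end

section
/- Let ℓ be an odd prime and let f = f_ℓ ∈ ℤ[x] be the Dickson polynomial of degree ℓ with parameter 1, characterized by f(x + x^{−1}) = x^ℓ + x^{−ℓ}. Then: (i) for every prime p, the number of z ∈ 𝔽_p that are periodic under the map z ↦ f(z) on 𝔽_p is at least (p − 3)/2; and (ii) for every ε > 0 there are infinitely many primes p such that the number of z ∈ 𝔽_p periodic under z ↦ f(z) is at most (1/2 + ε)·p. Consequently, the liminf over primes p of the proportion of f-periodic points in 𝔽_p equals 1/2. -/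
open Polynomial in
lemma dk_iter {R : Type*} [CommRing R] (l m : ℕ) (x y : R) (h : x * y = 1) :
    (fun w => ((dickson 1 (1 : ℤ) l).map (Int.castRingHom R)).eval w)^[m] (x + y)
      = x ^ (l ^ m) + y ^ (l ^ m) := by
  induction m with
  | zero => simp
  | succ m ih =>
    rw [Function.iterate_succ_apply', ih]
    have h2 : x ^ (l ^ m) * y ^ (l ^ m) = 1 := by rw [← mul_pow, h, one_pow]
    have := dickson_one_one_eval_add_inv _ _ h2 l
    simp only [map_dickson, map_one]
    rw [this, ← pow_mul, ← pow_mul, pow_succ]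

lemma dk_inj {F : Type*} [Field F] (u v : Fˣ)
    (h : (u : F) + (u⁻¹ : Fˣ) = (v : F) + (v⁻¹ : Fˣ)) : u = v ∨ u = v⁻¹ := by
  have hu : (u : F) * (u⁻¹ : Fˣ) = 1 := by simp
  have hv : (v : F) * (v⁻¹ : Fˣ) = 1 := by simp
  have h3 : ((u : F) - v) * ((u : F) - (v⁻¹ : Fˣ)) = 0 := by
    linear_combination (u : F) * h - hu + hv
  rcases mul_eq_zero.mp h3 with h4 | h4
  · left; ext; exact sub_eq_zero.mp h4
  · right; ext; exact sub_eq_zero.mp h4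

open Classical in
lemma dk_card {F : Type*} [Field F] (s : Finset Fˣ) :
    s.card ≤ 2 * (s.image (fun u : Fˣ => (u : F) + (u⁻¹ : Fˣ))).card := by
  apply Finset.card_le_mul_card_image
  intro b hb
  obtain ⟨v, hv, rfl⟩ := Finset.mem_image.mp hb
  refine (Finset.card_le_card (t := {v, v⁻¹}) ?_).trans Finset.card_le_two
  intro u hu
  have := dk_inj u v (Finset.mem_filter.mp hu).2
  simpa using this

open Classical in
lemma dk_lower (l p n : ℕ) [Fact p.Prime] (hn : 0 < n) (hl : Nat.Coprime l n)
    (hpn : n = p - 1 ∨ n = p + 1) :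
    n ≤ 2 * (Set.ncard {z : ZMod p | ∃ m : ℕ, 0 < m ∧
          (fun w => ((Polynomial.dickson 1 (1 : ℤ) l).map (Int.castRingHom (ZMod p))).eval w)^[m]
            z = z}) := by
  have hp : p.Prime := Fact.out
  set P := {z : ZMod p | ∃ m : ℕ, 0 < m ∧
          (fun w => ((Polynomial.dickson 1 (1 : ℤ) l).map (Int.castRingHom (ZMod p))).eval w)^[m]
            z = z} with hP
  let F := AlgebraicClosure (ZMod p)
  have : CharP F p := charP_of_injective_algebraMap (algebraMap (ZMod p) F).injective p
  have : NeZero n := ⟨hn.ne'⟩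
  have : NeZero (n : F) := ⟨by
    rw [Ne, CharP.cast_eq_zero_iff F p]
    intro hd
    have h2 := hp.two_le
    rcases hpn with h | h
    · have := Nat.le_of_dvd hn hd
      omega
    · rw [h, Nat.dvd_add_right (dvd_refl p)] at hd
      have := Nat.le_of_dvd one_pos hd
      omega⟩
  have hcard : Nat.card (rootsOfUnity n F) = n := HasEnoughRootsOfUnity.natCard_rootsOfUnity F n
  have hfin : (rootsOfUnity n F : Set Fˣ).Finite := by
    have : Finite (rootsOfUnity n F) := Nat.finite_of_card_ne_zero (by rw [hcard]; exact hn.ne')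
    exact Set.toFinite (rootsOfUnity n F : Set Fˣ)
  let s : Finset Fˣ := hfin.toFinset
  have hs : s.card = n := by
    rw [← Set.ncard_eq_toFinset_card _ hfin]; exact hcard
  have hfinP : P.Finite := Set.toFinite _
  have key : s.image (fun u : Fˣ => (u : F) + (u⁻¹ : Fˣ)) ⊆
      hfinP.toFinset.image (algebraMap (ZMod p) F) := by
    intro b hb
    obtain ⟨u, hu, rfl⟩ := Finset.mem_image.mp hb
    have hu1 : u ^ n = 1 := by
      have : u ∈ rootsOfUnity n F := by simpa [s] using hu
      exact (mem_rootsOfUnity n u).mp this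
    have hup : u ^ p = u ∨ u ^ p = u⁻¹ := by
      rcases hpn with h | h
      · left
        have : p = n + 1 := by have := hp.two_le; omega
        calc u ^ p = u ^ (n + 1) := congrArg (u ^ ·) this
          _ = u := by rw [pow_succ, hu1, one_mul]
      · right
        rw [h, pow_succ] at hu1
        exact eq_inv_of_mul_eq_one_left hu1
    have hfrob : ((u : F) + (u⁻¹ : Fˣ)) ^ p = (u : F) + (u⁻¹ : Fˣ) := by
      rw [add_pow_char, ← Units.val_pow_eq_pow_val, ← Units.val_pow_eq_pow_val, inv_pow]
      rcases hup with h | h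
      · rw [h]
      · rw [h, inv_inv, add_comm]
    obtain ⟨z, hz⟩ : ∃ z : ZMod p, algebraMap (ZMod p) F z = (u : F) + (u⁻¹ : Fˣ) := by
      obtain ⟨a, ha⟩ := (mem_bot_iff_intCast p F).mp
        ((Subfield.mem_bot_iff_pow_eq_self F p).mpr hfrob)
      exact ⟨a, by rw [map_intCast, ha]⟩
    refine Finset.mem_image.mpr ⟨z, ?_, hz⟩
    simp only [Set.Finite.mem_toFinset, hP, Set.mem_ofPred_eq]
    refine ⟨n.totient, Nat.totient_pos.mpr hn, ?_⟩
    apply (algebraMap (ZMod p) F).injective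
    have hsemi : Function.Semiconj (algebraMap (ZMod p) F)
      (fun w => ((Polynomial.dickson 1 (1 : ℤ) l).map (Int.castRingHom (ZMod p))).eval w)
      (fun w => ((Polynomial.dickson 1 (1 : ℤ) l).map (Int.castRingHom F)).eval w) := by
      intro w
      simp only [Polynomial.map_dickson, map_one]
      rw [← Polynomial.eval_map_apply, Polynomial.map_dickson, map_one]
    rw [(hsemi.iterate_right _).eq, hz, dk_iter l _ _ _ (by simp)]
    have hmod : l ^ n.totient ≡ 1 [MOD orderOf u] :=
      (Nat.ModEq.pow_totient hl).of_dvd (orderOf_dvd_of_pow_eq_one hu1)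
    have hpw : u ^ (l ^ n.totient) = u := by
      conv_rhs => rw [← pow_one u]
      exact pow_eq_pow_iff_modEq.mpr hmod
    rw [← Units.val_pow_eq_pow_val, ← Units.val_pow_eq_pow_val, inv_pow, hpw]
  have h1 := dk_card s
  have h2 := Finset.card_le_card key
  have h3 : (hfinP.toFinset.image (algebraMap (ZMod p) F)).card ≤ hfinP.toFinset.card :=
    Finset.card_image_le
  rw [Set.ncard_eq_toFinset_card _ hfinP]
  omega

open Classical in
lemma dk_upper (l p k d : ℕ) (hl : l.Prime) [Fact p.Prime] (hd : p - 1 = l ^ k * d) :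
    2 * (Set.ncard {z : ZMod p | ∃ m : ℕ, 0 < m ∧
          (fun w => ((Polynomial.dickson 1 (1 : ℤ) l).map (Int.castRingHom (ZMod p))).eval w)^[m]
            z = z}) ≤ p + 1 + 2 * d := by
  have hp : p.Prime := Fact.out
  have hp2 := hp.two_le
  set P := {z : ZMod p | ∃ m : ℕ, 0 < m ∧
          (fun w => ((Polynomial.dickson 1 (1 : ℤ) l).map (Int.castRingHom (ZMod p))).eval w)^[m]
            z = z} with hP
  have hfinP : P.Finite := Set.toFinite _
  have hd0 : 0 < d := by
    rcases Nat.eq_zero_or_pos d with h | h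
    · subst h; omega
    · exact h
  let g : (ZMod p)ˣ → ZMod p := fun u => (u : ZMod p) + (u⁻¹ : (ZMod p)ˣ)
  let S : Finset (ZMod p) := (Finset.univ : Finset (ZMod p)ˣ).image g
  let T : Finset (ZMod p)ˣ := Finset.univ.filter (fun u => u ^ d = 1)
  have hS : p - 1 ≤ 2 * S.card := by
    have := dk_card (Finset.univ : Finset (ZMod p)ˣ)
    rw [Finset.card_univ, ZMod.card_units] at this
    convert this
  have hT : T.card ≤ d := IsCyclic.card_pow_eq_one_le hd0
  have hSc : Sᶜ.card = p - S.card := by rw [Finset.card_compl, ZMod.card]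
  have key : hfinP.toFinset ⊆ Sᶜ ∪ T.image g := by
    intro z hz
    simp only [Set.Finite.mem_toFinset, hP, Set.mem_ofPred_eq] at hz
    rw [Finset.mem_union]
    by_cases hzS : z ∈ S
    · right
      obtain ⟨u, -, rfl⟩ := Finset.mem_image.mp hzS
      obtain ⟨m, hm, hmz⟩ := hz
      refine Finset.mem_image.mpr ⟨u, ?_, rfl⟩
      simp only [T, Finset.mem_filter, Finset.mem_univ, true_and]
      simp only [g] at hmz
      rw [dk_iter l _ _ _ (Units.mul_inv u), ← Units.val_pow_eq_pow_val, ← Units.val_pow_eq_pow_val,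
        inv_pow] at hmz
      have hlm : l ∣ l ^ m := dvd_pow_self l hm.ne'
      have hpos : 1 ≤ l ^ m := Nat.one_le_pow _ _ hl.pos
      have hcop : Nat.Coprime l (orderOf u) := by
        rw [Nat.Prime.coprime_iff_not_dvd hl]
        intro hdv
        rcases dk_inj _ _ hmz with h | h
        · have h1 : u ^ (l ^ m - 1) = 1 := by
            have : u ^ (l ^ m - 1) * u = 1 * u := by
              rw [← pow_succ, Nat.sub_add_cancel hpos, h, one_mul]
            exact mul_right_cancel this
          have h2 := hdv.trans (orderOf_dvd_of_pow_eq_one h1)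
          have h3 := (Nat.dvd_sub_iff_right hpos hlm).mp h2
          exact hl.one_lt.ne' (Nat.dvd_one.mp h3)
        · have h1 : u ^ (l ^ m + 1) = 1 := by
            rw [pow_succ, h, inv_mul_cancel]
          have h2 := hdv.trans (orderOf_dvd_of_pow_eq_one h1)
          have h3 := (Nat.dvd_add_right hlm).mp h2
          exact hl.one_lt.ne' (Nat.dvd_one.mp h3)
      have h5 : orderOf u ∣ l ^ k * d := by
        rw [← hd, ← ZMod.card_units p]; exact orderOf_dvd_card
      exact orderOf_dvd_iff_pow_eq_one.mp
        ((Nat.Coprime.pow_left k hcop).symm.dvd_of_dvd_mul_left h5)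
    · left; simpa using hzS
  have h1 := Finset.card_le_card key
  have h2 := Finset.card_union_le Sᶜ (T.image g)
  have h3 : (T.image g).card ≤ T.card := Finset.card_image_le
  rw [Set.ncard_eq_toFinset_card _ hfinP]
  omega

/-- For the Dickson (Chebyshev-type) polynomial `f = f_ℓ` of odd prime
degree `ℓ` with parameter `1`:
(i) for every prime `p`, at least `(p − 3)/2` points of `𝔽_p` are `f`-periodic; and
(ii) for every `ε > 0` there are infinitely many primes `p` for which the number of
`f`-periodic points in `𝔽_p` is at most `(1/2 + ε)·p`.
Consequently the liminf over primes `p` of the proportion of `f`-periodic points is `1/2`. -/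
theorem dickson_odd_prime_periodic_proportion (ℓ : ℕ) (hℓ : ℓ.Prime) (hodd : ℓ ≠ 2) :
    (∀ p : ℕ, p.Prime →
      ((p : ℝ) - 3) / 2 ≤
        (Set.ncard {z : ZMod p | ∃ m : ℕ, 0 < m ∧
          (fun w => ((Polynomial.dickson 1 (1 : ℤ) ℓ).map (Int.castRingHom (ZMod p))).eval w)^[m]
            z = z} : ℝ)) ∧
    (∀ ε : ℝ, 0 < ε →
      {p : ℕ | p.Prime ∧
        (Set.ncard {z : ZMod p | ∃ m : ℕ, 0 < m ∧
          (fun w => ((Polynomial.dickson 1 (1 : ℤ) ℓ).map (Int.castRingHom (ZMod p))).eval w)^[m]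
            z = z} : ℝ) ≤ (1 / 2 + ε) * p}.Infinite) := by
  constructor
  · intro p hp
    have : Fact p.Prime := ⟨hp⟩
    have hp2 := hp.two_le
    have hmain : p ≤ 2 * (Set.ncard {z : ZMod p | ∃ m : ℕ, 0 < m ∧
          (fun w => ((Polynomial.dickson 1 (1 : ℤ) ℓ).map (Int.castRingHom (ZMod p))).eval w)^[m]
            z = z}) + 3 := by
      by_cases h : ℓ ∣ p - 1
      · have h' : ¬ ℓ ∣ p + 1 := by
          intro h2
          have h3 : ℓ ∣ (p + 1) - (p - 1) := Nat.dvd_sub h2 h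
          have h4 : (p + 1) - (p - 1) = 2 := by omega
          rw [h4] at h3
          exact hodd ((Nat.prime_dvd_prime_iff_eq hℓ Nat.prime_two).mp h3)
        have := dk_lower ℓ p (p + 1) (by omega) ((Nat.Prime.coprime_iff_not_dvd hℓ).mpr h')
          (Or.inr rfl)
        omega
      · have := dk_lower ℓ p (p - 1) (by omega) ((Nat.Prime.coprime_iff_not_dvd hℓ).mpr h)
          (Or.inl rfl)
        omega
    have := (Nat.cast_le (α := ℝ)).mpr hmain
    push_cast at this
    linarith
  · intro ε hε
    apply Set.infinite_of_forall_exists_gt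
    intro N
    obtain ⟨k, hk⟩ := pow_unbounded_of_one_lt (2 / ε) (show (1 : ℝ) < ℓ by exact_mod_cast hℓ.one_lt)
    obtain ⟨M, hM⟩ := exists_nat_gt (1 / ε)
    obtain ⟨p, hp, hpN, hpm⟩ := Nat.exists_prime_gt_modEq_one (k := ℓ ^ k) (max N M)
      (pow_ne_zero _ hℓ.ne_zero)
    refine ⟨p, ⟨hp, ?_⟩, lt_of_le_of_lt (le_max_left _ _) hpN⟩
    have : Fact p.Prime := ⟨hp⟩
    obtain ⟨d, hd⟩ := (Nat.modEq_iff_dvd' hp.one_le).mp hpm.symm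
    have h := (Nat.cast_le (α := ℝ)).mpr (dk_upper ℓ p k d hℓ hd)
    push_cast at h
    have hpM : (M : ℝ) < p := by exact_mod_cast lt_of_le_of_lt (le_max_right _ _) hpN
    have h1 : 1 < ε * p := by
      have := hM.trans hpM
      rwa [div_lt_iff₀' hε] at this
    have h2 : (ℓ : ℝ) ^ k * d ≤ p := by
      have : ℓ ^ k * d ≤ p := by rw [← hd]; omega
      exact_mod_cast this
    have h3 : 2 * (d : ℝ) ≤ ε * p := by
      have h4 : 2 < ε * (ℓ : ℝ) ^ k := by rwa [div_lt_iff₀' hε] at hk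
      calc 2 * (d : ℝ) ≤ ε * (ℓ : ℝ) ^ k * d := by gcongr
        _ = ε * ((ℓ : ℝ) ^ k * d) := by ring
        _ ≤ ε * p := by gcongr
    linarith
end
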